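/- There exists a constant C > 0 such that every nested almost convex set X ⊆ ℝ² with n = |X| ≥ 1 points admits a drawing on an integer grid of size at most C·n^(log₂ 5): there exist a set Y ⊆ ℝ² all of whose points have integer coordinates of absolute value at most C·n^(log₂ 5), and a bijection f : X → Y such that for all pairwise distinct a, b, c ∈ X, orient(a,b,c) > 0 if and only if orient(f(a), f(b), f(c)) > 0. -/

import Mathlib

open Set

noncomputable section

/-- Points of the plane. -/
abbrev Pt : Type := ℝ × ℝ

/-- The orientation determinant of the triple `(a, b, c)`:
`c` lies strictly to the left of the directed line from `a` to `b` iff `orient a b c > 0`. -/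
def orient (a b c : Pt) : ℝ :=
  (b.1 - a.1) * (c.2 - a.2) - (b.2 - a.2) * (c.1 - a.1)

/-- A set of points is in general position if no three pairwise distinct points are collinear. -/
def GenPos (X : Set Pt) : Prop :=
  ∀ a ∈ X, ∀ b ∈ X, ∀ c ∈ X, a ≠ b → a ≠ c → b ≠ c → orient a b c ≠ 0

/-- The set of extreme points of the convex hull of `S`. -/
def extremePts (S : Set Pt) : Set Pt := Set.extremePoints ℝ (convexHull ℝ S)

/-- Remove the extreme points of the convex hull (one peeling step of convex layers). -/
def peel (S : Set Pt) : Set Pt := S \ extremePts S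

/-- `X` has exactly `k` convex layers. -/
def HasLayers (X : Set Pt) (k : ℕ) : Prop :=
  peel^[k] X = ∅ ∧ ∀ j < k, peel^[j] X ≠ ∅

/-- `X_j`, the union of the `j` innermost convex layers (when `X` has `k` layers). -/
def layerSub (X : Set Pt) (k j : ℕ) : Set Pt := peel^[k - j] X

/-- `R_j`, the `j`-th convex layer of `X` (when `X` has `k` layers), `R_1` innermost. -/
def layer (X : Set Pt) (k j : ℕ) : Set Pt := extremePts (layerSub X k j)

/-- `X` is a nested almost convex set. -/
def IsNACS (X : Set Pt) : Prop :=
  X.Finite ∧ X.Nonempty ∧ GenPos X ∧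
  ∀ k, HasLayers X k →
    ∀ j, 1 ≤ j → j ≤ k →
      ∀ a ∈ layer X k j, ∀ b ∈ layer X k j, ∀ c ∈ layer X k j,
        a ≠ b → a ≠ c → b ≠ c →
        ∃! p : Pt, p ∈ layerSub X k (j - 1) ∩ interior (convexHull ℝ ({a, b, c} : Set Pt))

/-- `q` is a counterclockwise enumeration of `S`. -/
def CCWEnum {m : ℕ} (S : Set Pt) (q : Fin m → Pt) : Prop :=
  Function.Injective q ∧ Set.range q = S ∧
  ∀ a b c : Fin m, a < b → b < c → 0 < orient (q a) (q b) (q c)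

/-- The ordered pair `(q1, q2)` of points of `R` is adoptable from `p`. -/
def AdoptablePair (R : Set Pt) (p q1 q2 : Pt) : Prop :=
  ∀ q3 ∈ R \ ({q1, q2} : Set Pt), p ∈ interior (convexHull ℝ ({q1, q2, q3} : Set Pt))

/-- The `i`-th binary string of length `j` in lexicographic order (`false` before `true`). -/
def strOfNat (j i : ℕ) : List Bool :=
  (List.range j).map fun t => i.testBit (j - 1 - t)

/-- The numeric (lexicographic) rank of a binary string among strings of its length. -/
def natOfStr (s : List Bool) : ℕ := s.foldl (fun n b => 2 * n + b.toNat) 0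

/-- The leftmost `k`-level descendant of the node `s`. -/
def firstStr (k : ℕ) (s : List Bool) : List Bool := s ++ List.replicate (k - s.length) false

/-- The rightmost `k`-level descendant of the node `s`. -/
def lastStr (k : ℕ) (s : List Bool) : List Bool := s ++ List.replicate (k - s.length) true

/-- Non-root nodes of the tree `T₁(k)`: binary strings of length `1..k`. -/
def ValidNode1 (k : ℕ) (s : List Bool) : Prop := 1 ≤ s.length ∧ s.length ≤ k

/-- A type-1 labeling of `X`, given by its label function `x` (the inverse of `ψ`). -/
def IsLabeling1 (k : ℕ) (X : Set Pt) (x : List Bool → Pt) : Prop :=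
  Set.InjOn x {s | ValidNode1 k s} ∧ x '' {s | ValidNode1 k s} = X

/-- A type-1 labeling is nested. -/
def Nested1 (k : ℕ) (X : Set Pt) (x : List Bool → Pt) : Prop :=
  ∀ j, 1 ≤ j → j ≤ k →
    CCWEnum (layer X k j) fun i : Fin (2 ^ j) => x (strOfNat j i.val)

/-- A type-1 labeling is adoptable. -/
def Adoptable1 (k : ℕ) (X : Set Pt) (x : List Bool → Pt) : Prop :=
  ∀ s : List Bool, 1 ≤ s.length → s.length + 1 ≤ k →
    AdoptablePair (layer X k (s.length + 1)) (x s) (x (s ++ [false])) (x (s ++ [true]))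

/-- `previous[R_k(u)]` for a type-1 labeling: the cyclic predecessor (in the left-to-right,
i.e. counterclockwise, order of the `k`-level) of `first[R_k(u)]`. -/
def prev1 (k : ℕ) (x : List Bool → Pt) (s : List Bool) : Pt :=
  x (strOfNat k ((natOfStr (firstStr k s) + (2 ^ k - 1)) % 2 ^ k))

/-- `next[R_k(u)]` for a type-1 labeling: the cyclic successor of `last[R_k(u)]`. -/
def next1 (k : ℕ) (x : List Bool → Pt) (s : List Bool) : Pt :=
  x (strOfNat k ((natOfStr (lastStr k s) + 1) % 2 ^ k))

/-- A type-1 labeling is well laid. -/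
def WellLaid1 (k : ℕ) (x : List Bool → Pt) : Prop :=
  ∀ s : List Bool, 1 ≤ s.length → s.length ≤ k →
    x s ∈ convexHull ℝ ({prev1 k x s, x (firstStr k s), x (lastStr k s)} : Set Pt) ∧
    x s ∈ convexHull ℝ ({x (firstStr k s), x (lastStr k s), next1 k x s} : Set Pt)

/-- `X_u` for a type-1 labeling: the labels of the proper descendants of `s`. -/
def descSet1 (k : ℕ) (x : List Bool → Pt) (s : List Bool) : Set Pt :=
  x '' {t | ValidNode1 k t ∧ s <+: t ∧ s ≠ t}

/-- `X̄_u = X_u ∪ {x_u}` for a type-1 labeling. -/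
def barSet1 (k : ℕ) (x : List Bool → Pt) (s : List Bool) : Set Pt :=
  insert (x s) (descSet1 k x s)

/-- A type-1 labeling is an internal separation. -/
def InternalSep1 (k : ℕ) (X : Set Pt) (x : List Bool → Pt) : Prop :=
  ∀ s : List Bool, s.length + 1 ≤ k →
    ∀ y ∈ X \ descSet1 k x s,
      ∀ a ∈ barSet1 k x (s ++ [false]), ∀ b ∈ barSet1 k x (s ++ [true]),
        0 < orient a b y

/-- A type-1 labeling is an external separation. -/
def ExternalSep1 (k : ℕ) (X : Set Pt) (x : List Bool → Pt) : Prop :=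
  ∀ s : List Bool, 1 ≤ s.length → s.length + 1 ≤ k →
    ∀ y ∈ X \ barSet1 k x s,
      (∀ a ∈ barSet1 k x (s ++ [false]), 0 < orient a (x s) y) ∧
      (∀ b ∈ barSet1 k x (s ++ [true]), 0 < orient (x s) b y)

/-- Nodes of the tree `T₂(k)`: the root `none`, and pairs `(c, s)`. -/
abbrev Node2 : Type := Option (Fin 3 × List Bool)

/-- Valid nodes of `T₂(k)`: the root, and pairs `(c, s)` with `|s| ≤ k - 2`. -/
def ValidNode2 (k : ℕ) : Node2 → Prop
  | none => True
  | some (_, s) => s.length + 2 ≤ k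

/-- A type-2 labeling of `X`, given by its label function `x` (the inverse of `ψ`). -/
def IsLabeling2 (k : ℕ) (X : Set Pt) (x : Node2 → Pt) : Prop :=
  Set.InjOn x {u | ValidNode2 k u} ∧ x '' {u | ValidNode2 k u} = X

/-- The `i`-th node (left-to-right) of the `(j+2)`-level of `T₂(k)`. -/
def node2At (j i : ℕ) : Node2 :=
  some (⟨i / 2 ^ j % 3, by omega⟩, strOfNat j (i % 2 ^ j))

/-- A type-2 labeling is nested. -/
def Nested2 (k : ℕ) (X : Set Pt) (x : Node2 → Pt) : Prop :=
  CCWEnum (layer X k 1) (fun _ : Fin 1 => x none) ∧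
  ∀ j : ℕ, j + 2 ≤ k →
    CCWEnum (layer X k (j + 2)) fun i : Fin (3 * 2 ^ j) => x (node2At j i.val)

/-- A type-2 labeling is adoptable. -/
def Adoptable2 (k : ℕ) (X : Set Pt) (x : Node2 → Pt) : Prop :=
  ∀ (c : Fin 3) (s : List Bool), s.length + 3 ≤ k →
    AdoptablePair (layer X k (s.length + 3)) (x (some (c, s)))
      (x (some (c, s ++ [false]))) (x (some (c, s ++ [true])))

/-- `previous[R_k(u)]` for a type-2 labeling, `u = (c, s)`. -/
def prev2 (k : ℕ) (x : Node2 → Pt) (c : Fin 3) (s : List Bool) : Pt :=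
  x (node2At (k - 2)
      ((c.val * 2 ^ (k - 2) + natOfStr (firstStr (k - 2) s) + (3 * 2 ^ (k - 2) - 1)) %
        (3 * 2 ^ (k - 2))))

/-- `next[R_k(u)]` for a type-2 labeling, `u = (c, s)`. -/
def next2 (k : ℕ) (x : Node2 → Pt) (c : Fin 3) (s : List Bool) : Pt :=
  x (node2At (k - 2)
      ((c.val * 2 ^ (k - 2) + natOfStr (lastStr (k - 2) s) + 1) % (3 * 2 ^ (k - 2))))

/-- A type-2 labeling is well laid (the root is the only node with `R_k(u) = R_k`). -/
def WellLaid2 (k : ℕ) (x : Node2 → Pt) : Prop :=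
  ∀ (c : Fin 3) (s : List Bool), s.length + 2 ≤ k →
    x (some (c, s)) ∈ convexHull ℝ
      ({prev2 k x c s, x (some (c, firstStr (k - 2) s)),
        x (some (c, lastStr (k - 2) s))} : Set Pt) ∧
    x (some (c, s)) ∈ convexHull ℝ
      ({x (some (c, firstStr (k - 2) s)), x (some (c, lastStr (k - 2) s)),
        next2 k x c s} : Set Pt)

/-- `X_u` for a type-2 labeling and a non-root node `u = (c, s)`. -/
def descSet2 (k : ℕ) (x : Node2 → Pt) (c : Fin 3) (s : List Bool) : Set Pt :=
  x '' {u | ∃ t : List Bool, u = some (c, t) ∧ t.length + 2 ≤ k ∧ s <+: t ∧ s ≠ t}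

/-- `X̄_u = X_u ∪ {x_u}` for a type-2 labeling and a non-root node `u = (c, s)`. -/
def barSet2 (k : ℕ) (x : Node2 → Pt) (c : Fin 3) (s : List Bool) : Set Pt :=
  insert (x (some (c, s))) (descSet2 k x c s)

/-- A type-2 labeling is an internal separation. -/
def InternalSep2 (k : ℕ) (X : Set Pt) (x : Node2 → Pt) : Prop :=
  (∀ (c : Fin 3) (s : List Bool), s.length + 3 ≤ k →
    ∀ y ∈ X \ descSet2 k x c s,
      ∀ a ∈ barSet2 k x c (s ++ [false]), ∀ b ∈ barSet2 k x c (s ++ [true]),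
        0 < orient a b y) ∧
  (∀ i : Fin 3,
    ∀ y ∈ X \ (barSet2 k x i [] ∪ barSet2 k x (i + 1) []),
      ∀ a ∈ barSet2 k x i [], ∀ b ∈ barSet2 k x (i + 1) [],
        0 < orient a b y)

/-- A type-2 labeling is an external separation. -/
def ExternalSep2 (k : ℕ) (X : Set Pt) (x : Node2 → Pt) : Prop :=
  ∀ (c : Fin 3) (s : List Bool), s.length + 3 ≤ k →
    ∀ y ∈ X \ barSet2 k x c s,
      (∀ a ∈ barSet2 k x c (s ++ [false]), 0 < orient a (x (some (c, s))) y) ∧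
      (∀ b ∈ barSet2 k x c (s ++ [true]), 0 < orient (x (some (c, s))) b y)

/-- One corner-refinement step: from `α_s = (q, o, p)` to `α_{s0}` (for `b = false`)
or `α_{s1}` (for `b = true`). -/
def cornerStep (α : Pt × Pt × Pt) (b : Bool) : Pt × Pt × Pt :=
  let q := α.1
  let o := α.2.1
  let p := α.2.2
  if b then (o + (1 / 5 : ℝ) • (q - o), o + (1 / 5 : ℝ) • (p - o), o + (2 / 5 : ℝ) • (p - o))
  else (o + (2 / 5 : ℝ) • (q - o), o + (1 / 5 : ℝ) • (q - o), o + (1 / 5 : ℝ) • (p - o))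

/-- The corner `α_s = (q_s, o_s, p_s)` assigned to the binary string `s` (with parameter `k`). -/
def corner (k : ℕ) (s : List Bool) : Pt × Pt × Pt :=
  s.foldl cornerStep
    (((0 : ℝ), (2 * 5 ^ (k + 1) : ℝ)), ((0 : ℝ), (0 : ℝ)), ((2 * 5 ^ (k + 1) : ℝ), (0 : ℝ)))

/-- The point `y_v` for a binary string `v = s ++ [b]` of positive length. -/
def ypt (k : ℕ) (v : List Bool) : Pt :=
  let α := corner k v.dropLast
  if v.getLastD false then α.2.1 + (1 / 5 : ℝ) • (α.2.2 - α.2.1)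
  else α.2.1 + (1 / 5 : ℝ) • (α.1 - α.2.1)

/-- The point `x_s`: the midpoint of `y_{s·0^(k+1−|s|)}` and `y_{s·1^(k+1−|s|)}`. -/
def xpt (k : ℕ) (s : List Bool) : Pt :=
  (1 / 2 : ℝ) •
    (ypt k (s ++ List.replicate (k + 1 - s.length) false) +
      ypt k (s ++ List.replicate (k + 1 - s.length) true))


open Classical

lemma o_rot (a b c : Pt) : orient b c a = orient a b c := by unfold orient; ring
lemma o_rot2 (a b c : Pt) : orient c a b = orient a b c := by unfold orient; ring
lemma o_swap (a b c : Pt) : orient b a c = - orient a b c := by unfold orient; ring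
lemma o_swap2 (a b c : Pt) : orient a c b = - orient a b c := by unfold orient; ring
lemma o_swap3 (a b c : Pt) : orient c b a = - orient a b c := by unfold orient; ring
lemma o_aab (a b : Pt) : orient a a b = 0 := by unfold orient; ring
lemma o_aba (a b : Pt) : orient a b a = 0 := by unfold orient; ring
lemma o_baa (a b : Pt) : orient b a a = 0 := by unfold orient; ring

/-- The two affine maps of the self-affine drawing. -/
def mp (c : Bool) (v : Pt) : Pt :=
  if c then (1/5 + v.1/5 - v.2/5, v.2/5) else (v.1/5, 1/5 - v.1/5 + v.2/5)

lemma o_mp (c : Bool) (u v w : Pt) : orient (mp c u) (mp c v) (mp c w) = orient u v w / 25 := by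
  cases c <;> simp [mp, orient] <;> ring

/-- The limit drawing: one point per binary string. -/
def yy : List Bool → Pt
  | [] => (13/100, 13/100)
  | c :: s => mp c (yy s)

def Box (v : Pt) : Prop := 0 ≤ v.1 ∧ v.1 ≤ 1/4 ∧ 0 ≤ v.2 ∧ v.2 ≤ 1/4

lemma box_mp (c : Bool) {v : Pt} (h : Box v) : Box (mp c v) := by
  obtain ⟨h1, h2, h3, h4⟩ := h
  cases c <;> simp only [mp, Box, if_true, if_false, Bool.false_eq_true] <;>
    refine ⟨?_, ?_, ?_, ?_⟩ <;> linarith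

lemma box_yy (s : List Bool) : Box (yy s) := by
  induction s with
  | nil => simp only [yy, Box]; norm_num
  | cons c s ih => exact box_mp c ih

def Far (w : Pt) : Prop := 0 ≤ w.1 ∧ 0 ≤ w.2 ∧ 3/4 ≤ w.1 + w.2

/-- inverse of `mp`. -/
def mpi (c : Bool) (v : Pt) : Pt :=
  if c then (5*v.1 + 5*v.2 - 1, 5*v.2) else (5*v.1, 5*v.1 + 5*v.2 - 1)

lemma mp_mpi (c : Bool) (v : Pt) : mp c (mpi c v) = v := by
  cases c <;> ext <;> simp [mp, mpi] <;> ring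

lemma far_mpi (c : Bool) {w : Pt} (h : Far w) : Far (mpi c w) := by
  obtain ⟨h1, h2, h3⟩ := h
  cases c <;> simp only [mpi, Far, if_true, if_false, Bool.false_eq_true] <;>
    refine ⟨?_, ?_, ?_⟩ <;> linarith

lemma far_nil (c : Bool) : Far (mpi c (yy [])) := by
  cases c <;> simp only [mpi, Far, yy, if_true, if_false, Bool.false_eq_true] <;> norm_num

lemma far_other (c : Bool) {v : Pt} (h : Box v) : Far (mpi c (mp (!c) v)) := by
  obtain ⟨h1, h2, h3, h4⟩ := h
  cases c <;> simp only [mp, mpi, Far, Bool.not_true, Bool.not_false, if_true, if_false,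
    Bool.false_eq_true] <;> refine ⟨?_, ?_, ?_⟩ <;> linarith

lemma y_int {a b w : Pt} (ha : Box a) (hb : Box b) (hw : Far w) :
    0 < orient (mp false a) (mp true b) w := by
  obtain ⟨a1, a2, a3, a4⟩ := ha
  obtain ⟨b1, b2, b3, b4⟩ := hb
  obtain ⟨w1, w2, w3⟩ := hw
  simp only [mp, orient, if_true, if_false, Bool.false_eq_true]
  nlinarith [mul_nonneg w1 a1, mul_nonneg w1 (sub_nonneg.2 a2), mul_nonneg w1 a3,
    mul_nonneg w1 (sub_nonneg.2 a4), mul_nonneg w2 a1, mul_nonneg w2 (sub_nonneg.2 a2),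
    mul_nonneg w2 a3, mul_nonneg w2 (sub_nonneg.2 a4), mul_nonneg w1 b1,
    mul_nonneg w1 (sub_nonneg.2 b2), mul_nonneg w1 b3, mul_nonneg w1 (sub_nonneg.2 b4),
    mul_nonneg w2 b1, mul_nonneg w2 (sub_nonneg.2 b2), mul_nonneg w2 b3,
    mul_nonneg w2 (sub_nonneg.2 b4), mul_nonneg a1 b1, mul_nonneg a1 b3, mul_nonneg a3 b1,
    mul_nonneg a3 b3, mul_nonneg (sub_nonneg.2 a2) b3, mul_nonneg (sub_nonneg.2 a4) b3,
    mul_nonneg (sub_nonneg.2 a4) (sub_nonneg.2 b2), mul_nonneg a1 (sub_nonneg.2 b4)]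

lemma y_int_nil {a b : Pt} (ha : Box a) (hb : Box b) :
    0 < orient (mp false a) (mp true b) (yy []) := by
  obtain ⟨a1, a2, a3, a4⟩ := ha
  obtain ⟨b1, b2, b3, b4⟩ := hb
  simp only [mp, orient, yy, if_true, if_false, Bool.false_eq_true]
  nlinarith [mul_nonneg a1 b1, mul_nonneg a1 b3, mul_nonneg a3 b1,
    mul_nonneg a3 b3, mul_nonneg (sub_nonneg.2 a2) b3, mul_nonneg (sub_nonneg.2 a4) b3,
    mul_nonneg (sub_nonneg.2 a4) (sub_nonneg.2 b2), mul_nonneg a1 (sub_nonneg.2 b4),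
    mul_nonneg (sub_nonneg.2 a2) (sub_nonneg.2 b4), mul_nonneg (sub_nonneg.2 a2) (sub_nonneg.2 b2)]

lemma y_extL {a w : Pt} (ha : Box a) (hw : Far w) :
    0 < orient (mp false a) (yy []) w := by
  obtain ⟨a1, a2, a3, a4⟩ := ha
  obtain ⟨w1, w2, w3⟩ := hw
  simp only [mp, orient, yy, if_false, Bool.false_eq_true]
  nlinarith [mul_nonneg w1 a1, mul_nonneg w1 (sub_nonneg.2 a2), mul_nonneg w1 a3,
    mul_nonneg w1 (sub_nonneg.2 a4), mul_nonneg w2 a1, mul_nonneg w2 (sub_nonneg.2 a2),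
    mul_nonneg w2 a3, mul_nonneg w2 (sub_nonneg.2 a4)]

lemma y_extR {b w : Pt} (ha : Box b) (hw : Far w) :
    0 < orient (yy []) (mp true b) w := by
  obtain ⟨a1, a2, a3, a4⟩ := ha
  obtain ⟨w1, w2, w3⟩ := hw
  simp only [mp, orient, yy, if_true]
  nlinarith [mul_nonneg w1 a1, mul_nonneg w1 (sub_nonneg.2 a2), mul_nonneg w1 a3,
    mul_nonneg w1 (sub_nonneg.2 a4), mul_nonneg w2 a1, mul_nonneg w2 (sub_nonneg.2 a2),
    mul_nonneg w2 a3, mul_nonneg w2 (sub_nonneg.2 a4)]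

lemma yyc (c : Bool) (s : List Bool) : yy (c :: s) = mp c (yy s) := rfl

lemma ya_far (s : List Bool) : ∀ w, Far w →
    0 < orient (yy (s ++ [false])) (yy s) w ∧ 0 < orient (yy s) (yy (s ++ [true])) w ∧
    0 < orient (yy (s ++ [false])) (yy (s ++ [true])) w := by
  induction s with
  | nil =>
    intro w hw
    exact ⟨y_extL (box_yy []) hw, y_extR (box_yy []) hw, y_int (box_yy []) (box_yy []) hw⟩
  | cons c s ih =>
    intro w hw
    have := ih _ (far_mpi c hw)
    simp only [List.cons_append, yyc]
    rw [← mp_mpi c w]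
    simp only [o_mp]
    refine ⟨?_, ?_, ?_⟩ <;> linarith [this.1, this.2.1, this.2.2]

lemma ya_self (s : List Bool) :
    0 < orient (yy (s ++ [false])) (yy (s ++ [true])) (yy s) := by
  induction s with
  | nil => exact y_int_nil (box_yy []) (box_yy [])
  | cons c s ih => simp only [List.cons_append, yyc, o_mp]; linarith

/-- A point not in branch `c` is far in the coordinates of branch `c`. -/
lemma far_of_ne {c : Bool} {v : List Bool} (h : ∀ v', v ≠ c :: v') :
    ∃ w, Far w ∧ yy v = mp c w := by
  cases v with
  | nil => exact ⟨_, far_nil c, (mp_mpi c _).symm⟩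
  | cons d v =>
    have hd : d = !c := by
      cases c <;> cases d <;> simp at h ⊢
    subst hd
    exact ⟨_, far_other c (box_yy v), (mp_mpi c _).symm⟩

lemma ya (s : List Bool) : ∀ v, ¬ s <+: v →
    0 < orient (yy (s ++ [false])) (yy s) (yy v) ∧ 0 < orient (yy s) (yy (s ++ [true])) (yy v) ∧
    0 < orient (yy (s ++ [false])) (yy (s ++ [true])) (yy v) := by
  induction s with
  | nil => intro v hv; exact absurd List.nil_prefix hv
  | cons c s ih =>
    intro v hv
    by_cases h : ∃ v', v = c :: v'
    · obtain ⟨v', rfl⟩ := h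
      have := ih v' (fun h => hv (by simpa using h))
      simp only [List.cons_append, yyc, o_mp]
      refine ⟨?_, ?_, ?_⟩ <;> linarith [this.1, this.2.1, this.2.2]
    · push Not at h
      obtain ⟨w, hw, hv⟩ := far_of_ne h
      have := ya_far s w hw
      simp only [List.cons_append, yyc, hv, o_mp]
      refine ⟨?_, ?_, ?_⟩ <;> linarith [this.1, this.2.1, this.2.2]

lemma o_mp_mul (c : Bool) {u v w u' v' w' : Pt} (h : 0 < orient u v w * orient u' v' w') :
    0 < orient (mp c u) (mp c v) (mp c w) * orient (mp c u') (mp c v') (mp c w') := by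
  simp only [o_mp]; linarith

lemma pp {a b : ℝ} (ha : 0 < a) (hb : 0 < b) : 0 < a * b := mul_pos ha hb

/-- orientation of a pair, seen from far, only depends on the pair of branches. -/
lemma y_base {c d : Bool} (hcd : c ≠ d) {a a' b b' w w' : Pt} (ha : Box a) (ha' : Box a')
    (hb : Box b) (hb' : Box b') (hw : Far w) (hw' : Far w') :
    0 < orient (mp c a) (mp d b) w * orient (mp c a') (mp d b') w' := by
  cases c <;> cases d
  · exact absurd rfl hcd
  · exact pp (y_int ha hb hw) (y_int ha' hb' hw')
  · rw [o_swap, o_swap (mp false b') ]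
    rw [neg_mul_neg]
    exact pp (y_int hb ha hw) (y_int hb' ha' hw')
  · exact absurd rfl hcd

lemma y_base_nil (c : Bool) {a a' w w' : Pt} (ha : Box a) (ha' : Box a')
    (hw : Far w) (hw' : Far w') :
    0 < orient (mp c a) (yy []) w * orient (mp c a') (yy []) w' := by
  cases c
  · exact pp (y_extL ha hw) (y_extL ha' hw')
  · rw [o_swap, o_swap (yy []) _ w', neg_mul_neg]
    exact pp (y_extR ha hw) (y_extR ha' hw')

lemma y_base_nil2 (c : Bool) {a a' b : Pt} (ha : Box a) (ha' : Box a') (hb : Box b) :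
    0 < orient (mp c a) (mp (!c) b) (yy []) * orient (mp c a') (mp (!c) b) (yy []) := by
  cases c
  · exact pp (y_int_nil ha hb) (y_int_nil ha' hb)
  · simp only [Bool.not_true]
    rw [o_swap, o_swap (mp false b) _ _, neg_mul_neg]
    exact pp (y_int_nil hb ha) (y_int_nil hb ha')

lemma yv (d : Bool) (s : List Bool) : ∀ u w, ¬ s <+: u → Far w →
    0 < orient (yy (s ++ [d])) (yy u) w * orient (yy s) (yy u) w := by
  induction s with
  | nil => intro v _ hv; exact absurd List.nil_prefix hv
  | cons c s ih =>
    intro u w hu hw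
    simp only [List.cons_append, yyc]
    rcases u with _ | ⟨e, u⟩
    · exact y_base_nil c (box_yy _) (box_yy _) hw hw
    · by_cases hce : c = e
      · subst hce
        rw [yyc, ← mp_mpi c w]
        exact o_mp_mul c (ih u _ (fun h => hu (by simpa using h)) (far_mpi c hw))
      · exact y_base hce (box_yy _) (box_yy _) (box_yy _) (box_yy _) hw hw

lemma yvi (u : List Bool) : ∀ v w w', u ≠ v → Far w → Far w' →
    0 < orient (yy u) (yy v) w * orient (yy u) (yy v) w' := by
  induction u with
  | nil =>
    intro v w w' huv hw hw'
    rcases v with _ | ⟨e, v⟩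
    · exact absurd rfl huv
    · rw [o_swap, o_swap _ (yy []) w', neg_mul_neg]
      exact y_base_nil e (box_yy _) (box_yy _) hw hw'
  | cons c u ih =>
    intro v w w' huv hw hw'
    rcases v with _ | ⟨e, v⟩
    · exact y_base_nil c (box_yy _) (box_yy _) hw hw'
    · by_cases hce : c = e
      · subst hce
        rw [yyc, yyc, ← mp_mpi c w, ← mp_mpi c w']
        exact o_mp_mul c (ih v _ _ (fun h => huv (by rw [h])) (far_mpi c hw) (far_mpi c hw'))
      · exact y_base hce (box_yy _) (box_yy _) (box_yy _) (box_yy _) hw hw'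

lemma yiv (d : Bool) (s : List Bool) : ∀ u v, ¬ s <+: u → ¬ s <+: v → u ≠ v →
    0 < orient (yy (s ++ [d])) (yy u) (yy v) * orient (yy s) (yy u) (yy v) := by
  induction s with
  | nil => intro v _ hv; exact absurd List.nil_prefix hv
  | cons c s ih =>
    intro u v hu hv huv
    simp only [List.cons_append, yyc]
    by_cases hcu : ∃ u', u = c :: u'
    · obtain ⟨u, rfl⟩ := hcu
      by_cases hcv : ∃ v', v = c :: v'
      · obtain ⟨v, rfl⟩ := hcv
        exact o_mp_mul c (ih u v (fun h => hu (by simpa using h)) (fun h => hv (by simpa using h))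
          (fun h => huv (by rw [h])))
      · push Not at hcv
        obtain ⟨w, hw, hv⟩ := far_of_ne hcv
        rw [hv]
        exact o_mp_mul c (yv d s u w (fun h => hu (by simpa using h)) hw)
    · by_cases hcv : ∃ v', v = c :: v'
      · obtain ⟨v, rfl⟩ := hcv
        push Not at hcu
        obtain ⟨w, hw, hu⟩ := far_of_ne hcu
        rw [hu, o_swap2, o_swap2 _ (yy (c :: v)), neg_mul_neg]
        exact o_mp_mul c (yv d s v w (fun h => hv (by simpa using h)) hw)
      · rcases u with _ | ⟨e, u⟩ <;> rcases v with _ | ⟨f, v⟩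
        · exact absurd rfl huv
        · have hf : f = !c := by
            cases c <;> cases f <;> simp at hcv ⊢
          subst hf
          rw [o_swap2, o_swap2 _ (yy ((!c) :: v)), neg_mul_neg]
          exact y_base_nil2 c (box_yy _) (box_yy _) (box_yy _)
        · have hf : e = !c := by
            cases c <;> cases e <;> simp at hcu ⊢
          subst hf
          exact y_base_nil2 c (box_yy _) (box_yy _) (box_yy _)
        · have hf : f = !c := by
            cases c <;> cases f <;> simp at hcv ⊢
          have he : e = !c := by
            cases c <;> cases e <;> simp at hcu ⊢
          subst hf; subst he
          have key : ∀ t : List Bool, ∃ w, Far w ∧ mp c (yy t) = mp (!c) w := fun t =>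
            far_of_ne (c := !c) (v := c :: t) (by intro v'; cases c <;> simp)
          obtain ⟨w, hw, h1⟩ := key (s ++ [d])
          obtain ⟨w', hw', h2⟩ := key s
          rw [h1, h2, ← o_rot, ← o_rot (mp (!c) w')]
          exact o_mp_mul (!c) (yvi u v w w' (fun h => huv (by rw [h])) hw hw')

lemma yy_inj : ∀ s t, yy s = yy t → s = t := by
  have hf : ∀ s, (yy (false :: s)).1 ≤ 1/20 := fun s => by
    have := (box_yy s).2.1
    simp only [yyc, mp, if_false, Bool.false_eq_true]; linarith
  have ht : ∀ s, 3/20 ≤ (yy (true :: s)).1 := fun s => by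
    have := box_yy s
    simp only [yyc, mp, if_true]; linarith [this.1, this.2.2.2]
  have hn : (yy []).1 = 13/100 := rfl
  have hm : ∀ c u v, mp c u = mp c v → u = v := by
    intro c u v h
    have h1 := congrArg Prod.fst h
    have h2 := congrArg Prod.snd h
    cases c <;> simp only [mp, if_true, if_false, Bool.false_eq_true] at h1 h2 <;>
      ext <;> linarith
  intro s
  induction s with
  | nil =>
    intro t h
    rcases t with _ | ⟨c, t⟩
    · rfl
    · exfalso
      rw [h] at hn
      cases c
      · linarith [hf t]
      · linarith [ht t]
  | cons c s ih =>
    intro t h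
    rcases t with _ | ⟨e, t⟩
    · exfalso
      rw [← h] at hn
      cases c
      · linarith [hf s]
      · linarith [ht s]
    · have : c = e := by
        by_contra hce
        have hh := congrArg Prod.fst h
        cases c <;> cases e
        · exact hce rfl
        · linarith [hf s, ht t]
        · linarith [hf t, ht s]
        · exact hce rfl
      subst this
      rw [ih t (hm c _ _ h)]

lemma yy_int (s : List Bool) : ∃ A B : ℤ, (100 * 5 ^ s.length : ℝ) * (yy s).1 = A ∧
    (100 * 5 ^ s.length : ℝ) * (yy s).2 = B := by
  induction s with
  | nil => exact ⟨13, 13, by simp [yy]; norm_num, by simp [yy]; norm_num⟩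
  | cons c s ih =>
    obtain ⟨A, B, hA, hB⟩ := ih
    simp only [yyc, List.length_cons, pow_succ]
    cases c <;> simp only [mp, if_true, if_false, Bool.false_eq_true]
    · refine ⟨A, 100 * 5 ^ s.length - A + B, ?_, ?_⟩ <;> push_cast <;> linarith
    · refine ⟨100 * 5 ^ s.length + A - B, B, ?_, ?_⟩ <;> push_cast <;> linarith


/-- `p` is strictly inside the counterclockwise triangle `a b c`. -/
def InT (a b c p : Pt) : Prop := 0 < orient a b p ∧ 0 < orient b c p ∧ 0 < orient c a p

/-- strictly exposed points of a finite set. -/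
def IsExt (S : Finset Pt) (q : Pt) : Prop :=
  ∃ α β : ℝ, ∀ x ∈ S, x ≠ q → 0 < α * (x.1 - q.1) + β * (x.2 - q.2)

def ext (S : Finset Pt) : Finset Pt := S.filter (IsExt S)

def core (S : Finset Pt) : Finset Pt := S \ ext S

def GP (S : Finset Pt) : Prop :=
  ∀ a ∈ S, ∀ b ∈ S, ∀ c ∈ S, a ≠ b → a ≠ c → b ≠ c → orient a b c ≠ 0

def AC (S : Finset Pt) : Prop :=
  ∀ a ∈ ext S, ∀ b ∈ ext S, ∀ c ∈ ext S, 0 < orient a b c → ∃! p, p ∈ core S ∧ InT a b c p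

lemma ext_sub (S : Finset Pt) : ext S ⊆ S := Finset.filter_subset _ _
lemma core_sub (S : Finset Pt) : core S ⊆ S := Finset.sdiff_subset

lemma ext_ne_core {S : Finset Pt} {q p : Pt} (hq : q ∈ ext S) (hp : p ∈ core S) : q ≠ p := by
  rintro rfl
  exact (Finset.mem_sdiff.1 hp).2 hq

lemma mem_or {S : Finset Pt} {x : Pt} (hx : x ∈ S) : x ∈ ext S ∨ x ∈ core S := by
  by_cases h : x ∈ ext S
  · exact Or.inl h
  · exact Or.inr (Finset.mem_sdiff.2 ⟨hx, h⟩)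

lemma o_sum (p a b c : Pt) : orient a b c = orient a b p + orient b c p + orient c a p := by
  unfold orient; ring

lemma o_aff (a b c x u v : Pt) : orient a b c * orient u v x =
    orient b c x * orient u v a + orient c a x * orient u v b + orient a b x * orient u v c := by
  unfold orient; ring

lemma o_pl (p a b x w : Pt) : orient p a b * orient p x w =
    orient p x b * orient p a w + orient p a x * orient p b w := by
  unfold orient; ring

lemma comb_pos {p a b x w : Pt} (h : 0 < orient p a b) (h1 : 0 < orient p x b)
    (h2 : 0 < orient p a x) (h3 : 0 < orient p a w) (h4 : 0 < orient p b w) :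
    0 < orient p x w := by
  have := o_pl p a b x w
  have h5 := mul_pos h1 h3
  have h6 := mul_pos h2 h4
  exact pos_of_mul_pos_right (by rw [this]; linarith) h.le

lemma comb_neg {p a b x w : Pt} (h : 0 < orient p a b) (h1 : 0 < orient p x b)
    (h2 : 0 < orient p a x) (h3 : orient p a w < 0) (h4 : orient p b w < 0) :
    orient p x w < 0 := by
  have := o_pl p a b x w
  have h5 := mul_neg_of_pos_of_neg h1 h3
  have h6 := mul_neg_of_pos_of_neg h2 h4
  by_contra hh
  have := mul_nonneg h.le (not_lt.1 hh)
  linarith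

lemma InT.pos {a b c p : Pt} (h : InT a b c p) : 0 < orient a b c := by
  rw [o_sum p]; linarith [h.1, h.2.1, h.2.2]

lemma InT.aff {a b c p u v : Pt} (h : InT a b c p) (ha : 0 ≤ orient u v a) (hb : 0 < orient u v b)
    (hc : 0 < orient u v c) : 0 < orient u v p := by
  have := o_aff a b c p u v
  have h1 := mul_nonneg h.2.1.le ha
  have h2 := mul_pos h.2.2 hb
  have h3 := mul_pos h.1 hc
  exact pos_of_mul_pos_right (by rw [this]; linarith) h.pos.le

lemma ext_not_InT {S : Finset Pt} {a b c q : Pt} (hq : q ∈ ext S) (ha : a ∈ S) (hb : b ∈ S)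
    (hc : c ∈ S) (h : InT a b c q) : False := by
  obtain ⟨_, α, β, hg⟩ := Finset.mem_filter.1 hq
  obtain ⟨h1, h2, h3⟩ := h
  have ga := hg a ha (by rintro rfl; rw [o_aba] at h1; exact lt_irrefl _ h1)
  have gb := hg b hb (by rintro rfl; rw [o_baa] at h1; exact lt_irrefl _ h1)
  have gc := hg c hc (by rintro rfl; rw [o_baa] at h2; exact lt_irrefl _ h2)
  have key : orient b c q * (α * (a.1 - q.1) + β * (a.2 - q.2)) +
      orient c a q * (α * (b.1 - q.1) + β * (b.2 - q.2)) +
      orient a b q * (α * (c.1 - q.1) + β * (c.2 - q.2)) = 0 := by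
    unfold orient; ring
  have := mul_pos h1 gc
  have := mul_pos h2 ga
  have := mul_pos h3 gb
  linarith

lemma exists_key {S : Finset Pt} {q : Pt} (hq : q ∈ ext S) : ∃ key : Pt → ℝ,
    ∀ x ∈ S, ∀ y ∈ S, x ≠ q → y ≠ q → (0 < orient q x y ↔ key x < key y) := by
  obtain ⟨_, α, β, hg⟩ := Finset.mem_filter.1 hq
  refine ⟨fun x => (-β * (x.1 - q.1) + α * (x.2 - q.2)) / (α * (x.1 - q.1) + β * (x.2 - q.2)), ?_⟩
  intro x hx y hy hxq hyq
  have gx := hg x hx hxq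
  have gy := hg y hy hyq
  have hpos : 0 < α ^ 2 + β ^ 2 := by
    by_contra hh
    have h1 : α = 0 := by nlinarith [sq_nonneg α, sq_nonneg β]
    have h2 : β = 0 := by nlinarith [sq_nonneg α, sq_nonneg β]
    subst h1; subst h2; simp at gx
  rw [div_lt_div_iff₀ gx gy]
  have : (-β * (y.1 - q.1) + α * (y.2 - q.2)) * (α * (x.1 - q.1) + β * (x.2 - q.2)) -
      (-β * (x.1 - q.1) + α * (x.2 - q.2)) * (α * (y.1 - q.1) + β * (y.2 - q.2)) =
      (α ^ 2 + β ^ 2) * orient q x y := by unfold orient; ring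
  constructor
  · intro h
    have := mul_pos hpos h
    linarith
  · intro h
    exact pos_of_mul_pos_right (by rw [← this]; linarith) hpos.le

/-- Link with Mathlib's extreme points. -/
lemma ext_coe (S : Finset Pt) : (↑(ext S) : Set Pt) = extremePts ↑S := by
  apply Set.Subset.antisymm
  · intro q hq
    obtain ⟨hqS, α, β, hg⟩ := Finset.mem_filter.1 hq
    set g : Pt → ℝ := fun x => α * (x.1 - q.1) + β * (x.2 - q.2) with hgdef
    have hC : Convex ℝ {x : Pt | x = q ∨ 0 < g x} := by
      intro x hx y hy a b ha hb hab
      have hlin : g (a • x + b • y) = a * g x + b * g y := by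
        have hb' : b = 1 - a := by linarith
        subst hb'
        simp only [hgdef, Prod.fst_add, Prod.snd_add, Prod.smul_fst, Prod.smul_snd, smul_eq_mul]
        ring
      have gq : g q = 0 := by simp [hgdef]
      rcases hx with rfl | hx <;> rcases hy with rfl | hy
      · left; rw [← add_smul, hab, one_smul]
      · rcases hb.eq_or_lt with rfl | hb
        · left; have : a = 1 := by linarith
          subst this; simp
        · right; rw [hlin, gq]; have := mul_pos hb hy; linarith
      · rcases ha.eq_or_lt with rfl | ha
        · left; have : b = 1 := by linarith
          subst this; simp
        · right; rw [hlin, gq]; have := mul_pos ha hx; linarith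
      · right; rw [hlin]
        rcases ha.eq_or_lt with rfl | ha
        · have : b = 1 := by linarith
          subst this; linarith
        · have := mul_pos ha hx
          have := mul_nonneg hb hy.le
          linarith
    have hsub : convexHull ℝ (↑S : Set Pt) ⊆ {x : Pt | x = q ∨ 0 < g x} := by
      apply convexHull_min _ hC
      intro x hx
      by_cases h : x = q
      · exact Or.inl h
      · exact Or.inr (hg x hx h)
    rw [extremePts, mem_extremePoints]
    refine ⟨subset_convexHull ℝ _ hqS, ?_⟩
    intro x hx y hy hxy
    obtain ⟨a, b, ha, hb, hab, he⟩ := hxy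
    have hlin : g (a • x + b • y) = a * g x + b * g y := by
      have hb' : b = 1 - a := by linarith
      subst hb'
      simp only [hgdef, Prod.fst_add, Prod.snd_add, Prod.smul_fst, Prod.smul_snd, smul_eq_mul]
      ring
    have gq : g q = 0 := by simp [hgdef]
    rw [he, gq] at hlin
    rcases hsub hx with hx | hx <;> rcases hsub hy with hy | hy
    · exact ⟨hx, hy⟩
    · rw [hx, gq] at hlin; have := mul_pos hb hy; linarith
    · rw [hy, gq] at hlin; have := mul_pos ha hx; linarith
    · have := mul_pos hb hy; have := mul_pos ha hx; linarith
  · intro q hq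
    have hqS : q ∈ (↑S : Set Pt) := extremePoints_convexHull_subset hq
    have h1 := (Convex.mem_extremePoints_iff_mem_sdiff_convexHull_sdiff (convex_convexHull ℝ _)).1 hq
    have h2 : q ∉ convexHull ℝ (↑(S.erase q) : Set Pt) := by
      intro h
      apply h1.2
      refine convexHull_mono ?_ h
      intro x hx
      rw [Finset.coe_erase] at hx
      exact ⟨subset_convexHull ℝ _ hx.1, hx.2⟩
    have hcl : IsClosed (convexHull ℝ (↑(S.erase q) : Set Pt)) :=
      ((S.erase q).finite_toSet.isCompact_convexHull (𝕜 := ℝ) (E := Pt)).isClosed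
    obtain ⟨f, u, hu, hf⟩ := geometric_hahn_banach_point_closed (convex_convexHull ℝ _) hcl h2
    have hfx : ∀ x : Pt, f x = f (1, 0) * x.1 + f (0, 1) * x.2 := by
      intro x
      have : x = x.1 • ((1 : ℝ), (0 : ℝ)) + x.2 • ((0 : ℝ), (1 : ℝ)) := by ext <;> simp
      conv_lhs => rw [this]
      rw [map_add, map_smul, map_smul, smul_eq_mul, smul_eq_mul]; ring
    refine Finset.mem_coe.2 (Finset.mem_filter.2 ⟨hqS, f (1, 0), f (0, 1), ?_⟩)
    intro x hx hxq
    have := hf x (subset_convexHull ℝ _ (by rw [Finset.coe_erase]; exact ⟨hx, hxq⟩))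
    rw [hfx] at this hu
    linarith

lemma supp {S : Finset Pt} {p : Pt} (hp : p ∈ S) (α β γ : ℝ)
    (h : ∀ q ∈ ext S, 0 ≤ α * q.1 + β * q.2 + γ) : 0 ≤ α * p.1 + β * p.2 + γ := by
  have hk := closure_convexHull_extremePoints (S.finite_toSet.isCompact_convexHull (𝕜 := ℝ) (E := Pt))
    (convex_convexHull ℝ _)
  have hp' : p ∈ convexHull ℝ (↑S : Set Pt) := subset_convexHull ℝ _ hp
  rw [← hk] at hp'
  have hcl : IsClosed {x : Pt | 0 ≤ α * x.1 + β * x.2 + γ} :=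
    isClosed_le continuous_const (by fun_prop)
  have hcv : Convex ℝ {x : Pt | 0 ≤ α * x.1 + β * x.2 + γ} := by
    intro x hx y hy a b ha hb hab
    simp only [Set.mem_ofPred_eq, Prod.fst_add, Prod.snd_add, Prod.smul_fst, Prod.smul_snd,
      smul_eq_mul] at *
    have h1 := mul_nonneg ha hx
    have h2 := mul_nonneg hb hy
    have h3 : γ = a * γ + b * γ := by rw [← add_mul, hab, one_mul]
    linarith
  refine closure_minimal (convexHull_min ?_ hcv) hcl hp'
  intro q hq
  have : q ∈ (↑(ext S) : Set Pt) := by rw [ext_coe]; exact hq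
  exact h q this

lemma supp_o {S : Finset Pt} {p : Pt} (hp : p ∈ S) (u v : Pt)
    (h : ∀ q ∈ ext S, 0 ≤ orient u v q) : 0 ≤ orient u v p := by
  have := supp hp (-(v.2 - u.2)) (v.1 - u.1) (-(v.1-u.1)*u.2 + (v.2-u.2)*u.1) (by
    intro q hq; have := h q hq; unfold orient at this; linarith)
  unfold orient; linarith

lemma conv4 {S : Finset Pt} (hS : GP S) {q x y z : Pt} (hq : q ∈ S) (hx : x ∈ S)
    (hy : y ∈ ext S) (hz : z ∈ S) (h1 : 0 < orient q x y) (h2 : 0 < orient q y z)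
    (h3 : 0 < orient q x z) : 0 < orient x y z := by
  by_contra hh
  have hxy : x ≠ y := by rintro rfl; rw [o_baa] at h1; exact lt_irrefl _ h1
  have hyz : y ≠ z := by rintro rfl; rw [o_baa] at h2; exact lt_irrefl _ h2
  have hxz : x ≠ z := by rintro rfl; rw [o_baa] at h3; exact lt_irrefl _ h3
  have h0 := hS x hx y (ext_sub _ hy) z hz hxy hxz hyz
  have h4 : orient x y z < 0 := lt_of_le_of_ne (not_lt.1 hh) h0
  exact ext_not_InT hy hq hx hz ⟨h1, by rw [o_swap2]; linarith, by rw [o_rot2 q y z]; exact h2⟩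

lemma InT.rot {a b c p : Pt} (h : InT a b c p) : InT b c a p := ⟨h.2.1, h.2.2, h.1⟩

lemma InT.aff0 {a b c p u v : Pt} (h : InT a b c p) (ha : 0 ≤ orient u v a) (hb : 0 ≤ orient u v b)
    (hc : 0 ≤ orient u v c) : 0 ≤ orient u v p := by
  have := o_aff a b c p u v
  have h1 := mul_nonneg h.2.1.le ha
  have h2 := mul_nonneg h.2.2.le hb
  have h3 := mul_nonneg h.1.le hc
  by_contra hh
  have := mul_neg_of_pos_of_neg h.pos (not_le.1 hh)
  linarith

lemma GP.mono {S T : Finset Pt} (hS : GP S) (h : T ⊆ S) : GP T :=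
  fun a ha b hb c hc => hS a (h ha) b (h hb) c (h hc)

lemma gp_or {S : Finset Pt} (hS : GP S) {a b c : Pt} (ha : a ∈ S) (hb : b ∈ S) (hc : c ∈ S)
    (hab : a ≠ b) (hac : a ≠ c) (hbc : b ≠ c) : 0 < orient a b c ∨ orient a b c < 0 := by
  rcases lt_trichotomy (orient a b c) 0 with h | h | h
  · exact Or.inr h
  · exact absurd h (hS a ha b hb c hc hab hac hbc)
  · exact Or.inl h

lemma gp_pos {S : Finset Pt} (hS : GP S) {a b c : Pt} (ha : a ∈ S) (hb : b ∈ S) (hc : c ∈ S)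
    (hab : a ≠ b) (hac : a ≠ c) (hbc : b ≠ c) (h : 0 ≤ orient a b c) : 0 < orient a b c :=
  lt_of_le_of_ne h (hS a ha b hb c hc hab hac hbc).symm

lemma o_ne12 {a b c : Pt} (h : 0 < orient a b c) : a ≠ b := by
  rintro rfl; rw [o_aab] at h; exact lt_irrefl _ h
lemma o_ne13 {a b c : Pt} (h : 0 < orient a b c) : a ≠ c := by
  rintro rfl; rw [o_aba] at h; exact lt_irrefl _ h
lemma o_ne23 {a b c : Pt} (h : 0 < orient a b c) : b ≠ c := by
  rintro rfl; rw [o_baa] at h; exact lt_irrefl _ h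

lemma fan {S : Finset Pt} (hS : GP S) (hA : AC S) {q0 : Pt} (hq0 : q0 ∈ ext S) (T : Finset Pt) :
    T ⊆ ext S → q0 ∉ T → T.Nonempty →
    ((core S).filter (fun p => ∃ x ∈ T, ∃ y ∈ T, InT q0 x y p)).card + 1 = T.card := by
  obtain ⟨key, hkey⟩ := exists_key hq0
  have hq0S := ext_sub _ hq0
  refine Finset.induction_on_max_value key T (fun _ _ h => absurd h (by simp)) ?_
  intro t T' htT hmax ih hsub hq hne
  have hsub' : T' ⊆ ext S := fun x hx => hsub (Finset.mem_insert_of_mem hx)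
  have hqT : q0 ∉ T' := fun h => hq (Finset.mem_insert_of_mem h)
  have ht : t ∈ ext S := hsub (Finset.mem_insert_self _ _)
  have htS := ext_sub _ ht
  have htq : t ≠ q0 := by rintro rfl; exact hq (Finset.mem_insert_self _ _)
  have hcmp : ∀ x ∈ ext S, ∀ y ∈ ext S, x ≠ q0 → y ≠ q0 → x ≠ y → key x ≤ key y →
      0 < orient q0 x y := by
    intro x hx y hy hxq hyq hxy hle
    rcases gp_or hS hq0S (ext_sub _ hx) (ext_sub _ hy) hxq.symm hyq.symm hxy with h | h
    · exact h
    · exfalso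
      have := (hkey y (ext_sub _ hy) x (ext_sub _ hx) hyq hxq).1 (by rw [o_swap2]; linarith)
      linarith
  have hT't : ∀ x ∈ T', 0 < orient q0 x t := by
    intro x hx
    exact hcmp x (hsub' hx) t ht (by rintro rfl; exact hqT hx) htq
      (by rintro rfl; exact htT hx) (hmax x hx)
  rcases T'.eq_empty_or_nonempty with rfl | hne'
  · rw [Finset.filter_false_of_mem]
    · simp
    · rintro p - ⟨x, hx, y, hy, h⟩
      simp at hx hy
      subst hx; subst hy
      exact o_ne12 h.2.1 rfl
  obtain ⟨t', ht', hmax'⟩ := Finset.exists_max_image T' key hne'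
  have ht'e := hsub' ht'
  have ht'q : t' ≠ q0 := by rintro rfl; exact hqT ht'
  have ihc := ih hsub' hqT hne'
  obtain ⟨p0, ⟨hp0c, hp0⟩, hp0u⟩ := hA q0 hq0 t' ht'e t ht (hT't t' ht')
  have heq : (core S).filter (fun p => ∃ x ∈ insert t T', ∃ y ∈ insert t T', InT q0 x y p) =
      insert p0 ((core S).filter (fun p => ∃ x ∈ T', ∃ y ∈ T', InT q0 x y p)) := by
    apply Finset.Subset.antisymm
    · intro p hp
      obtain ⟨hpc, x, hx, y, hy, h⟩ := Finset.mem_filter.1 hp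
      have hpS := core_sub _ hpc
      have hxy := h.pos
      have hxt : x ≠ t := by
        rintro rfl
        rcases Finset.mem_insert.1 hy with rfl | hy
        · exact o_ne23 hxy rfl
        · have := hT't y hy
          rw [o_swap2] at this; linarith
      have hxT := (Finset.mem_insert.1 hx).resolve_left hxt
      rcases Finset.mem_insert.1 hy with rfl | hyT
      · by_cases hxt' : x = t'
        · subst hxt'
          exact Finset.mem_insert.2 (Or.inl (hp0u p ⟨hpc, h⟩))
        · have h1 := hcmp x (hsub' hxT) t' ht'e (by rintro rfl; exact hqT hxT) ht'q hxt'
            (hmax' x hxT)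
          have h2 := hT't t' ht'
          have h3 := conv4 hS hq0S (ext_sub _ (hsub' hxT)) ht'e htS h1 h2 hxy
          rcases gp_or hS hq0S (ext_sub _ ht'e) hpS ht'q.symm (ext_ne_core hq0 hpc)
            (ext_ne_core ht'e hpc) with h4 | h4
          · refine Finset.mem_insert.2 (Or.inl (hp0u p ⟨hpc, h4, ?_, h.2.2⟩))
            refine h.rot.rot.aff (by rw [o_baa]) ?_ ?_
            · rw [o_rot]; exact h2
            · rw [o_rot]; exact h3
          · refine Finset.mem_insert_of_mem (Finset.mem_filter.2 ⟨hpc, x, hxT, t', ht', h.1, ?_, ?_⟩)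
            · refine h.rot.aff (by rw [o_aba]) h3 ?_
              rw [o_rot]; exact h1
            · rw [o_swap]; linarith
      · exact Finset.mem_insert_of_mem (Finset.mem_filter.2 ⟨hpc, x, hxT, y, hyT, h⟩)
    · intro p hp
      rcases Finset.mem_insert.1 hp with rfl | hp
      · exact Finset.mem_filter.2 ⟨hp0c, t', Finset.mem_insert_of_mem ht', t,
          Finset.mem_insert_self _ _, hp0⟩
      · obtain ⟨hpc, x, hx, y, hy, h⟩ := Finset.mem_filter.1 hp
        exact Finset.mem_filter.2 ⟨hpc, x, Finset.mem_insert_of_mem hx, y,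
          Finset.mem_insert_of_mem hy, h⟩
  have hnot : p0 ∉ (core S).filter (fun p => ∃ x ∈ T', ∃ y ∈ T', InT q0 x y p) := by
    intro hp
    obtain ⟨hpc, x, hx, y, hy, h⟩ := Finset.mem_filter.1 hp
    have hz : ∀ z ∈ T', 0 ≤ orient t' q0 z := by
      intro z hz
      by_cases hzt : z = t'
      · subst hzt; rw [o_aba]
      · have := hcmp z (hsub' hz) t' ht'e (by rintro rfl; exact hqT hz) ht'q hzt (hmax' z hz)
        rw [o_rot2 q0 z t']; exact this.le
    have := h.aff0 (u := t') (v := q0) (by rw [o_baa]) (hz x hx) (hz y hy)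
    have h5 := hp0.1
    rw [o_swap] at this
    linarith
  rw [heq, Finset.card_insert_of_notMem hnot, Finset.card_insert_of_notMem htT, ihc]

lemma full {S : Finset Pt} (hS : GP S) {q0 : Pt} (hq0 : q0 ∈ ext S) {p : Pt} (hp : p ∈ core S) :
    ∃ x ∈ (ext S).erase q0, ∃ y ∈ (ext S).erase q0, InT q0 x y p := by
  obtain ⟨key, hkey⟩ := exists_key hq0
  have hq0S := ext_sub _ hq0
  have hpS := core_sub _ hp
  have hpq : q0 ≠ p := ext_ne_core hq0 hp
  have hT : ((ext S).erase q0).Nonempty := by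
    by_contra hh
    rw [Finset.not_nonempty_iff_eq_empty] at hh
    have hall : ∀ q ∈ ext S, q = q0 := by
      intro q hq
      by_contra hne
      have : q ∈ (ext S).erase q0 := Finset.mem_erase.2 ⟨hne, hq⟩
      rw [hh] at this; simp at this
    obtain ⟨_, α, β, hg⟩ := Finset.mem_filter.1 hq0
    have h1 := hg p hpS hpq.symm
    have h2 := supp hpS (-α) (-β) (α * q0.1 + β * q0.2) (by
      intro q hq; rw [hall q hq]; linarith)
    linarith
  have hcmp : ∀ x ∈ S, ∀ y ∈ S, x ≠ q0 → y ≠ q0 → x ≠ y → key x ≤ key y →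
      0 < orient q0 x y := by
    intro x hx y hy hxq hyq hxy hle
    rcases gp_or hS hq0S hx hy hxq.symm hyq.symm hxy with h | h
    · exact h
    · exfalso
      have := (hkey y hy x hx hyq hxq).1 (by rw [o_swap2]; linarith)
      linarith
  have hTe : ∀ z ∈ (ext S).erase q0, z ∈ ext S ∧ z ∈ S ∧ z ≠ q0 ∧ z ≠ p := fun z hz =>
    ⟨(Finset.mem_erase.1 hz).2, ext_sub _ (Finset.mem_erase.1 hz).2, (Finset.mem_erase.1 hz).1,
      ext_ne_core (Finset.mem_erase.1 hz).2 hp⟩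
  have hA : (((ext S).erase q0).filter (fun z => 0 < orient q0 z p)).Nonempty := by
    obtain ⟨t, ht, hmin⟩ := Finset.exists_min_image _ key hT
    obtain ⟨h1, h2, h3, h4⟩ := hTe t ht
    refine ⟨t, Finset.mem_filter.2 ⟨ht, gp_pos hS hq0S h2 hpS h3.symm hpq h4 (supp_o hpS _ _ ?_)⟩⟩
    intro z hz
    by_cases hzq : z = q0
    · subst hzq; rw [o_aba]
    by_cases hzt : z = t
    · subst hzt; rw [o_baa]
    exact (hcmp t h2 z (ext_sub _ hz) h3 hzq (Ne.symm hzt) (hmin z (Finset.mem_erase.2 ⟨hzq, hz⟩))).le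
  have hB : (((ext S).erase q0).filter (fun z => 0 < orient q0 p z)).Nonempty := by
    obtain ⟨t, ht, hmax⟩ := Finset.exists_max_image _ key hT
    obtain ⟨h1, h2, h3, h4⟩ := hTe t ht
    refine ⟨t, Finset.mem_filter.2 ⟨ht, ?_⟩⟩
    rw [← o_rot2 q0 p t]
    refine gp_pos hS h2 hq0S hpS h3 h4 hpq (supp_o hpS _ _ ?_)
    intro z hz
    by_cases hzq : z = q0
    · subst hzq; rw [o_baa]
    by_cases hzt : z = t
    · subst hzt; rw [o_aba]
    rw [o_rot2 q0 z t]
    exact (hcmp z (ext_sub _ hz) t h2 hzq h3 hzt (hmax z (Finset.mem_erase.2 ⟨hzq, hz⟩))).le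
  obtain ⟨x, hx, hxm⟩ := Finset.exists_max_image _ key hA
  obtain ⟨y, hy, hym⟩ := Finset.exists_min_image _ key hB
  obtain ⟨hxT, hxp⟩ := Finset.mem_filter.1 hx
  obtain ⟨hyT, hyp⟩ := Finset.mem_filter.1 hy
  obtain ⟨hxe, hxS, hxq, hxp'⟩ := hTe x hxT
  obtain ⟨hye, hyS, hyq, hyp'⟩ := hTe y hyT
  have k1 := (hkey x hxS p hpS hxq hpq.symm).1 hxp
  have k2 := (hkey p hpS y hyS hpq.symm hyq).1 hyp
  have hxy : 0 < orient q0 x y := (hkey x hxS y hyS hxq hyq).2 (k1.trans k2)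
  refine ⟨x, hxT, y, hyT, hxp, ?_, by rw [o_rot2 q0 p y]; exact hyp⟩
  refine gp_pos hS hxS hyS hpS (o_ne23 hxy) hxp' hyp' (supp_o hpS _ _ ?_)
  intro z hz
  by_cases hzq : z = q0
  · subst hzq; rw [o_rot]; exact hxy.le
  by_cases hzx : z = x
  · subst hzx; rw [o_aba]
  by_cases hzy : z = y
  · subst hzy; rw [o_baa]
  have hzS := ext_sub _ hz
  have hzT : z ∈ (ext S).erase q0 := Finset.mem_erase.2 ⟨hzq, hz⟩
  rcases gp_or hS hq0S hzS hpS (Ne.symm hzq) hpq (ext_ne_core hz hp) with h | h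
  · have hle := hxm z (Finset.mem_filter.2 ⟨hzT, h⟩)
    have h1 := hcmp z hzS x hxS hzq hxq hzx hle
    have h2 := hcmp z hzS y hyS hzq hyq hzy (by linarith)
    rw [o_rot]
    exact (conv4 hS hq0S hzS hxe hyS h1 hxy h2).le
  · have h : 0 < orient q0 p z := by rw [o_swap2]; linarith
    have hle := hym z (Finset.mem_filter.2 ⟨hzT, h⟩)
    have h1 := hcmp y hyS z hzS hyq hzq (Ne.symm hzy) hle
    have h2 := hcmp x hxS z hzS hxq hzq (Ne.symm hzx) (by linarith)
    exact (conv4 hS hq0S hxS hye hzS hxy h1 h2).le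

lemma ext_nonempty {S : Finset Pt} (h : S.Nonempty) : (ext S).Nonempty := by
  by_contra hh
  rw [Finset.not_nonempty_iff_eq_empty] at hh
  obtain ⟨p, hp⟩ := h
  have := supp hp 0 0 (-1) (by rw [hh]; simp)
  linarith

lemma card_ext {S : Finset Pt} (hS : GP S) (hA : AC S) (hc : (core S).Nonempty) :
    (ext S).card = (core S).card + 2 := by
  obtain ⟨p, hp⟩ := hc
  obtain ⟨q0, hq0⟩ := ext_nonempty ⟨p, core_sub _ hp⟩
  obtain ⟨x, hx, -⟩ := full hS hq0 hp
  have := fan hS hA hq0 ((ext S).erase q0) (Finset.erase_subset _ _) (Finset.notMem_erase _ _) ⟨x, hx⟩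
  rw [Finset.filter_true_of_mem (fun p hp => full hS hq0 hp)] at this
  have h2 := Finset.card_erase_add_one hq0
  omega

lemma lb {S : Finset Pt} (hS : GP S) (hA : AC S) {q0 : Pt} (hq0 : q0 ∈ ext S) (T : Finset Pt)
    (hT : T ⊆ ext S) (hqT : q0 ∉ T) (u v : Pt) (h0 : 0 ≤ orient u v q0)
    (h : ∀ t ∈ T, 0 < orient u v t) :
    T.card ≤ ((core S).filter (fun w => 0 < orient u v w)).card + 1 := by
  rcases T.eq_empty_or_nonempty with rfl | hne
  · simp
  rw [← fan hS hA hq0 T hT hqT hne]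
  apply Nat.succ_le_succ
  apply Finset.card_le_card
  intro p hp
  obtain ⟨hpc, x, hx, y, hy, hI⟩ := Finset.mem_filter.1 hp
  exact Finset.mem_filter.2 ⟨hpc, hI.aff h0 (h x hx) (h y hy)⟩

lemma lb2 {S : Finset Pt} (hS : GP S) (hA : AC S) (u v : Pt) :
    ((ext S).filter (fun w => 0 < orient u v w)).card ≤
      ((core S).filter (fun w => 0 < orient u v w)).card + 2 := by
  rcases ((ext S).filter (fun w => 0 < orient u v w)).eq_empty_or_nonempty with h | ⟨q0, hq0⟩
  · rw [h]; simp
  have h1 := Finset.mem_filter.1 hq0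
  have := lb hS hA h1.1 (((ext S).filter (fun w => 0 < orient u v w)).erase q0)
    (fun x hx => (Finset.mem_filter.1 (Finset.mem_erase.1 hx).2).1) (Finset.notMem_erase _ _) u v
    h1.2.le (fun x hx => (Finset.mem_filter.1 (Finset.mem_erase.1 hx).2).2)
  have h2 := Finset.card_erase_add_one hq0
  omega

lemma split_card {S : Finset Pt} (hS : GP S) {A : Finset Pt} (hA : A ⊆ S) {u v : Pt} (hu : u ∈ S)
    (hv : v ∈ S) (huv : u ≠ v) :
    (A.filter (fun w => 0 < orient u v w)).card + (A.filter (fun w => 0 < orient v u w)).card =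
      (A \ {u, v}).card := by
  rw [← Finset.card_union_of_disjoint]
  · congr 1
    ext1 w
    simp only [Finset.mem_union, Finset.mem_filter, Finset.mem_sdiff, Finset.mem_insert,
      Finset.mem_singleton]
    constructor
    · rintro (⟨h1, h2⟩ | ⟨h1, h2⟩)
      · exact ⟨h1, by rintro (rfl | rfl); exacts [o_ne13 h2 rfl, o_ne23 h2 rfl]⟩
      · exact ⟨h1, by rintro (rfl | rfl); exacts [o_ne23 h2 rfl, o_ne13 h2 rfl]⟩
    · rintro ⟨h1, h2⟩
      push Not at h2
      rcases gp_or hS hu hv (hA h1) huv h2.1.symm h2.2.symm with h | h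
      · exact Or.inl ⟨h1, h⟩
      · exact Or.inr ⟨h1, by rw [o_swap]; linarith⟩
  · rw [Finset.disjoint_left]
    intro w h1 h2
    have h1 := (Finset.mem_filter.1 h1).2
    have h2 := (Finset.mem_filter.1 h2).2
    rw [o_swap] at h2
    linarith

lemma card_sd2 {A : Finset Pt} {u v : Pt} (hu : u ∈ A) (hv : v ∈ A) (h : u ≠ v) :
    (A \ {u, v}).card + 2 = A.card := by
  rw [← Finset.card_pair h]
  exact Finset.card_sdiff_add_card_eq_card (by
    intro x hx
    rcases Finset.mem_insert.1 hx with rfl | hx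
    · exact hu
    · rw [Finset.mem_singleton.1 hx]; exact hv)

lemma cl1 {S : Finset Pt} (hS : GP S) (hA : AC S) {u v : Pt} (hu : u ∈ core S) (hv : v ∈ core S)
    (huv : u ≠ v) : ((ext S).filter (fun w => 0 < orient u v w)).card =
      ((core S).filter (fun w => 0 < orient u v w)).card + 2 := by
  have h1 := split_card hS (ext_sub S) (core_sub _ hu) (core_sub _ hv) huv
  have h2 := split_card hS (core_sub S) (core_sub _ hu) (core_sub _ hv) huv
  have h3 := lb2 hS hA u v
  have h4 := lb2 hS hA v u
  have h5 := card_ext hS hA ⟨u, hu⟩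
  have h6 := card_sd2 hu hv huv
  have h7 : (ext S \ {u, v}) = ext S := by
    rw [Finset.sdiff_eq_self_iff_disjoint, Finset.disjoint_left]
    intro w hw hw2
    rcases Finset.mem_insert.1 hw2 with rfl | hw2
    · exact ext_ne_core hw hu rfl
    · rw [Finset.mem_singleton] at hw2; exact ext_ne_core hw hv hw2
  rw [h7] at h1
  omega

lemma cl2 {S : Finset Pt} (hS : GP S) (hA : AC S) {u q : Pt} (hu : u ∈ core S) (hq : q ∈ ext S) :
    ((ext S).filter (fun w => 0 < orient u q w)).card =
      ((core S).filter (fun w => 0 < orient u q w)).card + 1 := by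
  have huq : u ≠ q := (ext_ne_core hq hu).symm
  have h1 := split_card hS (ext_sub S) (core_sub _ hu) (ext_sub _ hq) huq
  have h2 := split_card hS (core_sub S) (core_sub _ hu) (ext_sub _ hq) huq
  have h3 := lb hS hA hq ((ext S).filter (fun w => 0 < orient u q w)) (Finset.filter_subset _ _)
    (by intro h; exact o_ne23 (Finset.mem_filter.1 h).2 rfl) u q (by rw [o_baa])
    (fun t ht => (Finset.mem_filter.1 ht).2)
  have h4 := lb hS hA hq ((ext S).filter (fun w => 0 < orient q u w)) (Finset.filter_subset _ _)
    (by intro h; exact o_ne13 (Finset.mem_filter.1 h).2 rfl) q u (by rw [o_aba])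
    (fun t ht => (Finset.mem_filter.1 ht).2)
  have h5 := card_ext hS hA ⟨u, hu⟩
  have h6 : (core S \ {u, q}).card + 1 = (core S).card := by
    have : core S \ {u, q} = (core S).erase u := by
      ext1 w
      simp only [Finset.mem_sdiff, Finset.mem_insert, Finset.mem_singleton, Finset.mem_erase]
      constructor
      · rintro ⟨a, b⟩; exact ⟨fun h => b (Or.inl h), a⟩
      · rintro ⟨a, b⟩; exact ⟨b, by rintro (h | h); exacts [a h, ext_ne_core hq b h.symm]⟩
    rw [this]; exact Finset.card_erase_add_one hu
  have h7 : (ext S \ {u, q}).card + 1 = (ext S).card := by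
    have : ext S \ {u, q} = (ext S).erase q := by
      ext1 w
      simp only [Finset.mem_sdiff, Finset.mem_insert, Finset.mem_singleton, Finset.mem_erase]
      constructor
      · rintro ⟨a, b⟩; exact ⟨fun h => b (Or.inr h), a⟩
      · rintro ⟨a, b⟩; exact ⟨b, by rintro (h | h); exacts [ext_ne_core b hu h, a h]⟩
    rw [this]; exact Finset.card_erase_add_one hq
  omega

lemma tmax {S : Finset Pt} (hS : GP S) {I : Finset Pt} (hI : I ⊆ S) {q : Pt} (hq : q ∈ ext S)
    (hqI : q ∉ I) (hne : I.Nonempty) : ∃ p ∈ I, ∀ v ∈ I, v ≠ p → 0 < orient p q v := by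
  obtain ⟨key, hkey⟩ := exists_key hq
  obtain ⟨p, hp, hmax⟩ := Finset.exists_max_image I key hne
  refine ⟨p, hp, fun v hv hvp => ?_⟩
  have h1 : p ≠ q := by rintro rfl; exact hqI hp
  have h2 : v ≠ q := by rintro rfl; exact hqI hv
  rw [o_rot2 q v p]
  rcases gp_or hS (ext_sub _ hq) (hI hv) (hI hp) h2.symm h1.symm hvp with h | h
  · exact h
  · have := (hkey p (hI hp) v (hI hv) h1 h2).1 (by rw [o_swap2]; linarith)
    have := hmax v hv
    linarith

lemma tmin {S : Finset Pt} (hS : GP S) {I : Finset Pt} (hI : I ⊆ S) {q : Pt} (hq : q ∈ ext S)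
    (hqI : q ∉ I) (hne : I.Nonempty) : ∃ p ∈ I, ∀ v ∈ I, v ≠ p → 0 < orient q p v := by
  obtain ⟨key, hkey⟩ := exists_key hq
  obtain ⟨p, hp, hmin⟩ := Finset.exists_min_image I key hne
  refine ⟨p, hp, fun v hv hvp => ?_⟩
  have h1 : p ≠ q := by rintro rfl; exact hqI hp
  have h2 : v ≠ q := by rintro rfl; exact hqI hv
  rcases gp_or hS (ext_sub _ hq) (hI hp) (hI hv) h1.symm h2.symm hvp.symm with h | h
  · exact h
  · have := (hkey v (hI hv) p (hI hp) h2 h1).1 (by rw [o_swap2]; linarith)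
    have := hmin v hv
    linarith

lemma ext_of_line {I : Finset Pt} {p q : Pt} (hp : p ∈ I)
    (h : ∀ v ∈ I, v ≠ p → 0 < orient p q v) : p ∈ ext I := by
  refine Finset.mem_filter.2 ⟨hp, -(q.2 - p.2), q.1 - p.1, ?_⟩
  intro x hx hxp
  have := h x hx hxp
  unfold orient at this
  linarith

lemma ext_of_line2 {I : Finset Pt} {p q : Pt} (hp : p ∈ I)
    (h : ∀ v ∈ I, v ≠ p → 0 < orient q p v) : p ∈ ext I := by
  refine Finset.mem_filter.2 ⟨hp, -(p.2 - q.2), p.1 - q.1, ?_⟩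
  intro x hx hxp
  have := h x hx hxp
  unfold orient at this
  linarith

lemma ext_of_edge {I : Finset Pt} {p r : Pt} (hr : r ∈ I) (hpr : p ≠ r)
    (h : ∀ v ∈ I, v ≠ p → v ≠ r → 0 < orient p r v) : r ∈ ext I := by
  set c : Pt → ℝ := fun v => (p.1 - r.1) * (v.1 - r.1) + (p.2 - r.2) * (v.2 - r.2) with hc
  have hK : ∃ K : ℝ, ∀ v ∈ I, v ≠ p → v ≠ r → 0 < K * orient p r v + c v := by
    refine ⟨∑ v ∈ I.filter (fun v => v ≠ p ∧ v ≠ r), (|c v| + 1) / orient p r v, ?_⟩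
    intro v hv hvp hvr
    have ho := h v hv hvp hvr
    have h1 : (|c v| + 1) / orient p r v ≤
        ∑ v ∈ I.filter (fun v => v ≠ p ∧ v ≠ r), (|c v| + 1) / orient p r v := by
      refine Finset.single_le_sum (f := fun v => (|c v| + 1) / orient p r v) ?_
        (Finset.mem_filter.2 ⟨hv, hvp, hvr⟩)
      intro w hw
      obtain ⟨h2, h3, h4⟩ := Finset.mem_filter.1 hw
      exact div_nonneg (by positivity) (h w h2 h3 h4).le
    have h2 := mul_le_mul_of_nonneg_right h1 ho.le
    rw [div_mul_cancel₀ _ ho.ne'] at h2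
    have := neg_abs_le (c v)
    linarith
  obtain ⟨K, hK⟩ := hK
  refine Finset.mem_filter.2 ⟨hr, -K * (r.2 - p.2) + (p.1 - r.1), K * (r.1 - p.1) + (p.2 - r.2), ?_⟩
  intro x hx hxr
  by_cases hxp : x = p
  · subst hxp
    have h3 : 0 < (x.1 - r.1) ^ 2 + (x.2 - r.2) ^ 2 := by
      by_contra hh
      have h1 : x.1 - r.1 = 0 := by nlinarith [sq_nonneg (x.1 - r.1), sq_nonneg (x.2 - r.2)]
      have h2 : x.2 - r.2 = 0 := by nlinarith [sq_nonneg (x.1 - r.1), sq_nonneg (x.2 - r.2)]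
      exact hxr (Prod.ext (by linarith) (by linarith))
    linarith
  · have := hK x hx hxp hxr
    simp only [hc] at this
    unfold orient at this
    linarith

lemma succ_exists {I : Finset Pt} (hI : GP I) (h2 : 2 ≤ I.card) : ∃ σ : Pt → Pt,
    (∀ p ∈ ext I, σ p ∈ ext I ∧ σ p ≠ p ∧ ∀ v ∈ I, v ≠ p → v ≠ σ p → 0 < orient p (σ p) v) ∧
    ∀ r ∈ ext I, ∃ p ∈ ext I, σ p = r := by
  have hex : ∀ p, ∃ r, p ∈ ext I → r ∈ ext I ∧ r ≠ p ∧
      ∀ v ∈ I, v ≠ p → v ≠ r → 0 < orient p r v := by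
    intro p
    by_cases hp : p ∈ ext I
    · have hpI := ext_sub _ hp
      have hne : (I.erase p).Nonempty := by
        rw [← Finset.card_pos]
        have := Finset.card_erase_add_one hpI
        omega
      obtain ⟨r, hr, hmin⟩ := tmin hI (Finset.erase_subset p I) hp (Finset.notMem_erase _ _) hne
      obtain ⟨hrp, hrI⟩ := Finset.mem_erase.1 hr
      have h3 : ∀ v ∈ I, v ≠ p → v ≠ r → 0 < orient p r v := fun v hv hvp hvr =>
        hmin v (Finset.mem_erase.2 ⟨hvp, hv⟩) hvr
      exact ⟨r, fun _ => ⟨ext_of_edge hrI hrp.symm h3, hrp, h3⟩⟩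
    · exact ⟨p, fun h => absurd h hp⟩
  choose σ hσ using hex
  refine ⟨σ, hσ, ?_⟩
  have hinj : Set.InjOn σ (ext I) := by
    intro p hp p' hp' he
    by_contra hne
    obtain ⟨_, hn1, h1⟩ := hσ p hp
    obtain ⟨_, hn2, h3⟩ := hσ p' hp'
    have h4 := h1 p' (ext_sub _ hp') (Ne.symm hne) (by rw [he]; exact hn2.symm)
    have h5 := h3 p (ext_sub _ hp) hne (by rw [← he]; exact hn1.symm)
    rw [← he, o_swap3] at h5
    linarith
  intro r hr
  have := Finset.surjOn_of_injOn_of_card_le σ (s := ext I) (t := ext I)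
    (fun p hp => (hσ p hp).1) hinj le_rfl hr
  obtain ⟨p, hp, rfl⟩ := this
  exact ⟨p, hp, rfl⟩

lemma card_two_core {S : Finset Pt} (hS : GP S) (hA : AC S) (hA' : AC (core S))
    (h2 : 2 ≤ (core S).card) : (ext S).card = 2 * (ext (core S)).card := by
  have hI : GP (core S) := hS.mono (core_sub S)
  have h1 := card_ext hS hA (Finset.card_pos.1 (by omega))
  have h3 : (core (core S)).card + (ext (core S)).card = (core S).card :=
    Finset.card_sdiff_add_card_eq_card (ext_sub _)
  rcases (core (core S)).eq_empty_or_nonempty with he | hne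
  · have h4 : (ext (core S)).card ≤ 2 := by
      by_contra hh
      obtain ⟨a, b, c, ha, hb, hc, hab, hac, hbc⟩ := Finset.two_lt_card_iff.1 (not_le.1 hh)
      rcases gp_or hI (ext_sub _ ha) (ext_sub _ hb) (ext_sub _ hc) hab hac hbc with h | h
      · obtain ⟨p, hp, -⟩ := hA' a ha b hb c hc h
        rw [he] at hp; simp at hp
      · obtain ⟨p, hp, -⟩ := hA' b hb a ha c hc (by rw [o_swap]; linarith)
        rw [he] at hp; simp at hp
    rw [he] at h3
    simp at h3
    omega
  · have := card_ext hI hA' hne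
    omega

lemma cl2b {S : Finset Pt} (hS : GP S) (hA : AC S) {u q : Pt} (hu : u ∈ core S) (hq : q ∈ ext S) :
    ((ext S).filter (fun w => 0 < orient q u w)).card =
      ((core S).filter (fun w => 0 < orient q u w)).card + 1 := by
  have huq : u ≠ q := (ext_ne_core hq hu).symm
  have h0 := cl2 hS hA hu hq
  have h1 := split_card hS (ext_sub S) (core_sub _ hu) (ext_sub _ hq) huq
  have h2 := split_card hS (core_sub S) (core_sub _ hu) (ext_sub _ hq) huq
  have h5 := card_ext hS hA ⟨u, hu⟩
  have h6 : (core S \ {u, q}).card + 1 = (core S).card := by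
    have : core S \ {u, q} = (core S).erase u := by
      ext1 w
      simp only [Finset.mem_sdiff, Finset.mem_insert, Finset.mem_singleton, Finset.mem_erase]
      constructor
      · rintro ⟨a, b⟩; exact ⟨fun h => b (Or.inl h), a⟩
      · rintro ⟨a, b⟩; exact ⟨b, by rintro (h | h); exacts [a h, ext_ne_core hq b h.symm]⟩
    rw [this]; exact Finset.card_erase_add_one hu
  have h7 : (ext S \ {u, q}).card + 1 = (ext S).card := by
    have : ext S \ {u, q} = (ext S).erase q := by
      ext1 w
      simp only [Finset.mem_sdiff, Finset.mem_insert, Finset.mem_singleton, Finset.mem_erase]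
      constructor
      · rintro ⟨a, b⟩; exact ⟨fun h => b (Or.inr h), a⟩
      · rintro ⟨a, b⟩; exact ⟨b, by rintro (h | h); exacts [ext_ne_core b hu h, a h]⟩
    rw [this]; exact Finset.card_erase_add_one hq
  omega

/-- The children of the points of the second layer. -/
structure Fam (S : Finset Pt) (a b : Pt → Pt) : Prop where
  am : ∀ p ∈ ext (core S), a p ∈ ext S
  bm : ∀ p ∈ ext (core S), b p ∈ ext S
  abp : ∀ p ∈ ext (core S), 0 < orient (a p) (b p) p
  ap : ∀ p ∈ ext (core S), ∀ v ∈ S, v ≠ a p → v ≠ b p → v ≠ p → 0 < orient (a p) p v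
  pb : ∀ p ∈ ext (core S), ∀ v ∈ S, v ≠ a p → v ≠ b p → v ≠ p → 0 < orient p (b p) v
  ab : ∀ p ∈ ext (core S), ∀ v ∈ S, v ≠ a p → v ≠ b p → 0 < orient (a p) (b p) v
  cov : ∀ q ∈ ext S, ∃ p ∈ ext (core S), q = a p ∨ q = b p
  ia : ∀ p ∈ ext (core S), ∀ p' ∈ ext (core S), a p = a p' → p = p'
  ib : ∀ p ∈ ext (core S), ∀ p' ∈ ext (core S), b p = b p' → p = p'
  ne : ∀ p ∈ ext (core S), ∀ p' ∈ ext (core S), a p ≠ b p'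

lemma fam_exists {S : Finset Pt} (hS : GP S) (hA : AC S) (hA' : AC (core S))
    (h2 : 2 ≤ (core S).card) : ∃ a b, Fam S a b := by
  have hI : GP (core S) := hS.mono (core_sub S)
  have hIne : (core S).Nonempty := Finset.card_pos.1 (by omega)
  have hcS : ∀ p ∈ ext (core S), p ∈ core S := fun p hp => ext_sub _ hp
  obtain ⟨σ, hσ, hσs⟩ := succ_exists hI h2
  have hτ : ∀ q, ∃ p, q ∈ ext S → p ∈ ext (core S) ∧ ∀ v ∈ core S, v ≠ p → 0 < orient p q v := by
    intro q
    by_cases hq : q ∈ ext S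
    · obtain ⟨p, hp, h⟩ := tmax hS (core_sub S) hq (fun h => ext_ne_core hq h rfl) hIne
      exact ⟨p, fun _ => ⟨ext_of_line hp h, h⟩⟩
    · exact ⟨q, fun h => absurd h hq⟩
  choose τ hτ using hτ
  set B : Pt → Finset Pt := fun p => (ext S).filter (fun w => 0 < orient (σ p) p w) with hB
  have hBc : ∀ p ∈ ext (core S), (B p).card = 2 := by
    intro p hp
    obtain ⟨h1, h3, h4⟩ := hσ p hp
    have := cl1 hS hA (hcS _ h1) (hcS _ hp) h3
    rw [Finset.filter_false_of_mem (s := core S)] at this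
    · simpa using this
    · intro w hw
      by_cases hwp : w = p
      · subst hwp; rw [o_baa]; simp
      by_cases hws : w = σ p
      · subst hws; rw [o_aba]; simp
      have := h4 w hw hwp hws
      rw [o_swap]; linarith
  have hτB : ∀ q ∈ ext S, q ∈ B (τ q) := by
    intro q hq
    obtain ⟨h1, h3⟩ := hτ q hq
    refine Finset.mem_filter.2 ⟨hq, ?_⟩
    rw [← o_rot]
    exact h3 _ (hcS _ (hσ _ h1).1) (hσ _ h1).2.1
  have hfib : ∀ p ∈ ext (core S), (ext S).filter (fun q => τ q = p) = B p := by
    have hle : ∀ p ∈ ext (core S), (ext S).filter (fun q => τ q = p) ⊆ B p := by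
      intro p hp q hq
      obtain ⟨h1, h3⟩ := Finset.mem_filter.1 hq
      have := hτB q h1
      rwa [h3] at this
    have h4 : (ext S).card = ∑ p ∈ ext (core S), ((ext S).filter (fun q => τ q = p)).card :=
      Finset.card_eq_sum_card_fiberwise (fun q hq => (hτ q hq).1)
    have h5 : ∑ p ∈ ext (core S), (B p).card = (ext S).card := by
      rw [Finset.sum_congr rfl hBc, Finset.sum_const, card_two_core hS hA hA' h2]
      simp [mul_comm]
    have h6 := (Finset.sum_eq_sum_iff_of_le (fun p hp => Finset.card_le_card (hle p hp))).1
      (h4.symm.trans h5.symm)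
    intro p hp
    exact Finset.eq_of_subset_of_card_le (hle p hp) (h6 p hp).ge
  have hτiff : ∀ p ∈ ext (core S), ∀ q ∈ ext S, 0 < orient (σ p) p q → τ q = p := by
    intro p hp q hq h
    have : q ∈ B p := Finset.mem_filter.2 ⟨hq, h⟩
    rw [← hfib p hp] at this
    exact (Finset.mem_filter.1 this).2
  have hba : ∀ p, ∃ b al, p ∈ ext (core S) → B p = {b, al} ∧ 0 < orient p b al := by
    intro p
    by_cases hp : p ∈ ext (core S)
    · obtain ⟨x, y, hxy, he⟩ := Finset.card_eq_two.1 (hBc p hp)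
      have hx : x ∈ ext S := (Finset.mem_filter.1 (show x ∈ B p by rw [he]; simp)).1
      have hy : y ∈ ext S := (Finset.mem_filter.1 (show y ∈ B p by rw [he]; simp)).1
      rcases gp_or hS (core_sub _ (hcS _ hp)) (ext_sub _ hx) (ext_sub _ hy)
        (ext_ne_core hx (hcS _ hp)).symm (ext_ne_core hy (hcS _ hp)).symm hxy with h | h
      · exact ⟨x, y, fun _ => ⟨he, h⟩⟩
      · exact ⟨y, x, fun _ => ⟨by rw [he, Finset.pair_comm], by rw [o_swap2]; linarith⟩⟩
    · exact ⟨p, p, fun h => absurd h hp⟩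
  choose b al hba using hba
  have hbB : ∀ p ∈ ext (core S), b p ∈ ext S ∧ 0 < orient (σ p) p (b p) := by
    intro p hp
    exact Finset.mem_filter.1 (show b p ∈ B p by rw [(hba p hp).1]; simp)
  have haB : ∀ p ∈ ext (core S), al p ∈ ext S ∧ 0 < orient (σ p) p (al p) := by
    intro p hp
    exact Finset.mem_filter.1 (show al p ∈ B p by rw [(hba p hp).1]; simp)
  have hBmem : ∀ p ∈ ext (core S), ∀ q ∈ ext S, 0 < orient (σ p) p q → q = b p ∨ q = al p := by
    intro p hp q hq h
    have : q ∈ B p := Finset.mem_filter.2 ⟨hq, h⟩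
    rw [(hba p hp).1] at this
    simpa using this
  have hτb : ∀ p ∈ ext (core S), τ (b p) = p := fun p hp => hτiff p hp _ (hbB p hp).1 (hbB p hp).2
  have hτa : ∀ p ∈ ext (core S), τ (al p) = p := fun p hp => hτiff p hp _ (haB p hp).1 (haB p hp).2
  have hpr : ∀ p, ∃ o, p ∈ ext (core S) → o ∈ ext (core S) ∧ σ o = p := by
    intro p
    by_cases hp : p ∈ ext (core S)
    · obtain ⟨o, h1, h3⟩ := hσs p hp
      exact ⟨o, fun _ => ⟨h1, h3⟩⟩
    · exact ⟨p, fun h => absurd h hp⟩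
  choose pr hpr using hpr
  -- main facts
  have main : ∀ p ∈ ext (core S), 0 < orient (al (pr p)) (b p) p ∧
      ∀ v ∈ S, v ≠ al (pr p) → v ≠ b p → v ≠ p →
        0 < orient (al (pr p)) p v ∧ 0 < orient p (b p) v := by
    intro p hp
    obtain ⟨ho, hop⟩ := hpr p hp
    set o := pr p with ho_def
    have hpI := hcS _ hp
    have hoI := hcS _ ho
    have hpS := core_sub _ hpI
    have hoS := core_sub _ hoI
    obtain ⟨hbE, hbB'⟩ := hbB p hp
    obtain ⟨haE, haB'⟩ := haB o ho
    obtain ⟨hβE, hβB'⟩ := hbB o ho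
    rw [hop] at haB' hβB'
    obtain ⟨hpp, hppne, hppv⟩ := hσ p hp
    have hopne : o ≠ p := by rw [← hop]; exact (hσ o ho).2.1.symm
    have hab : al o ≠ b p := by
      intro h
      have := hτb p hp
      rw [← h, hτa o ho] at this
      exact hopne this
    have F1 : ∀ v ∈ core S, v ≠ p → 0 < orient p (b p) v := by
      have := (hτ _ hbE).2
      rwa [hτb p hp] at this
    have F2 : ∀ v ∈ core S, v ≠ p → 0 < orient (al o) p v := by
      obtain ⟨r, hr, hrm⟩ := tmin hS (core_sub S) haE (fun h => ext_ne_core haE h rfl) hIne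
      have hre := ext_of_line2 hr hrm
      obtain ⟨s, hs, hsr⟩ := hσs r hre
      have hsne : s ≠ r := by rw [← hsr]; exact (hσ s hs).2.1.symm
      have h3 := hrm s (hcS _ hs) hsne
      have h4 := hτiff s hs _ haE (by rw [hsr, ← o_rot2]; exact h3)
      rw [hτa o ho] at h4
      have : r = p := by rw [← hsr, ← h4, hop]
      rw [this] at hrm
      exact hrm
    have F3 : 0 < orient (al o) p (b o) := by
      have hne := o_ne23 (hba o ho).2
      rcases gp_or hS (ext_sub _ haE) hpS (ext_sub _ hβE) (ext_ne_core haE hpI) hne.symm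
        (ext_ne_core hβE hpI).symm with h | h
      · exact h
      · exfalso
        exact ext_not_InT haE hoS (ext_sub _ hβE) hpS
          ⟨(hba o ho).2, by rw [o_swap3]; linarith, haB'⟩
    have cb := cl2b hS hA hpI hbE
    rw [Finset.filter_false_of_mem (s := core S)] at cb
    swap
    · intro w hw
      by_cases hwp : w = p
      · subst hwp; rw [o_baa]; simp
      have := F1 w hw hwp
      rw [o_swap]; linarith
    obtain ⟨x, hx⟩ := Finset.card_eq_one.1 (by simpa using cb)
    have hxm : x ∈ (ext S).filter (fun w => 0 < orient (b p) p w) := by rw [hx]; simp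
    obtain ⟨hxE, hxo⟩ := Finset.mem_filter.1 hxm
    have hxu : ∀ q ∈ ext S, q ≠ x → ¬ 0 < orient (b p) p q := by
      intro q hq hqx h
      have : q ∈ (ext S).filter (fun w => 0 < orient (b p) p w) := Finset.mem_filter.2 ⟨hq, h⟩
      rw [hx] at this
      exact hqx (Finset.mem_singleton.1 this)
    have hxa : x = al o := by
      have hxb : x ≠ b p := (o_ne13 hxo).symm
      have hxal : x ≠ al p := by
        rintro rfl
        have := (hba p hp).2
        rw [o_swap] at this
        linarith
      have hxp : x ≠ p := ext_ne_core hxE hpI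
      have n1 : ¬ 0 < orient (σ p) p x := by
        intro h
        rcases hBmem p hp x hxE h with h | h
        · exact hxb h
        · exact hxal h
      have n1' : 0 < orient p (σ p) x := by
        rcases gp_or hS (core_sub _ (hcS _ hpp)) hpS (ext_sub _ hxE) hppne
          (ext_ne_core hxE (hcS _ hpp)).symm hxp.symm with h | h
        · exact absurd h n1
        · rw [o_swap]; linarith
      by_cases n2 : 0 < orient p o x
      · rw [← hop] at n2
        rcases hBmem o ho x hxE n2 with h | h
        · exfalso
          subst h
          have e := o_pl p (b o) (al o) (b p) o
          have h3 : 0 < orient p (b o) (al o) := by rw [o_rot]; exact F3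
          have h4 : 0 < orient p (b p) o := F1 o hoI hopne
          have h5 : 0 < orient p (b p) (al o) := by
            have := hxu (al o) haE (o_ne23 (hba o ho).2).symm
            rcases gp_or hS hpS (ext_sub _ hbE) (ext_sub _ haE) (ext_ne_core hbE hpI).symm
              (ext_ne_core haE hpI).symm hab.symm with h | h
            · exact h
            · exfalso; apply this; rw [o_swap]; linarith
          have h6 : 0 < orient p (b o) (b p) := by rw [o_rot]; exact hxo
          have h7 : orient p (b o) o < 0 := by rw [o_swap2]; linarith
          have h8 : orient p (al o) o < 0 := by rw [o_swap2]; linarith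
          have := mul_pos h3 h4
          have := mul_neg_of_pos_of_neg h5 h7
          have := mul_neg_of_pos_of_neg h6 h8
          linarith
        · exact h
      · exfalso
        have n2' : 0 < orient p x o := by
          rcases gp_or hS hpS hoS (ext_sub _ hxE) hopne.symm hxp.symm
            (ext_ne_core hxE hoI).symm with h | h
          · exact absurd h n2
          · rw [o_swap2]; linarith
        by_cases hpo : o = σ p
        · rw [hpo] at n2'; rw [o_swap2] at n2'; linarith
        · have h3 := hppv o hoI hopne hpo
          have h4 := comb_neg h3 n2' n1' (w := b p) (by rw [o_swap]; linarith)
            (by rw [o_swap2]; linarith [F1 o hoI hopne])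
          rw [← o_rot] at hxo
          linarith
    rw [hxa] at hxo hxu
    have habp : 0 < orient (al o) (b p) p := by rw [← o_rot]; exact hxo
    have F4 : ∀ q ∈ ext S, q ≠ al o → q ≠ b p → 0 < orient p (b p) q := by
      intro q hq h3 h4
      rcases gp_or hS hpS (ext_sub _ hbE) (ext_sub _ hq) (ext_ne_core hbE hpI).symm
        (ext_ne_core hq hpI).symm h4.symm with h | h
      · exact h
      · exfalso; apply hxu q hq h3; rw [o_swap]; linarith
    have ca := cl2 hS hA hpI haE
    rw [Finset.filter_false_of_mem (s := core S)] at ca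
    swap
    · intro w hw
      by_cases hwp : w = p
      · subst hwp; rw [o_aba]; simp
      have := F2 w hw hwp
      rw [o_swap]; linarith
    obtain ⟨y, hy⟩ := Finset.card_eq_one.1 (by simpa using ca)
    have hby : b p ∈ (ext S).filter (fun w => 0 < orient p (al o) w) :=
      Finset.mem_filter.2 ⟨hbE, by rw [o_rot2]; exact habp⟩
    rw [hy, Finset.mem_singleton] at hby
    have F5 : ∀ q ∈ ext S, q ≠ al o → q ≠ b p → 0 < orient (al o) p q := by
      intro q hq h3 h4
      rcases gp_or hS (ext_sub _ haE) hpS (ext_sub _ hq) (ext_ne_core haE hpI) h3.symm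
        (ext_ne_core hq hpI).symm with h | h
      · exact h
      · exfalso
        have : q ∈ (ext S).filter (fun w => 0 < orient p (al o) w) :=
          Finset.mem_filter.2 ⟨hq, by rw [o_swap]; linarith⟩
        rw [hy, Finset.mem_singleton] at this
        exact h4 (this.trans hby.symm)
    refine ⟨habp, fun v hv h3 h4 h5 => ?_⟩
    rcases mem_or hv with hv | hv
    · exact ⟨F5 v hv h3 h4, F4 v hv h3 h4⟩
    · exact ⟨F2 v hv h5, F1 v hv h5⟩
  refine ⟨fun p => al (pr p), b, ?_, ?_, ?_, ?_, ?_, ?_, ?_, ?_, ?_, ?_⟩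
  · exact fun p hp => (haB _ (hpr p hp).1).1
  · exact fun p hp => (hbB _ hp).1
  · exact fun p hp => (main p hp).1
  · exact fun p hp v hv h1 h3 h4 => ((main p hp).2 v hv h1 h3 h4).1
  · exact fun p hp v hv h1 h3 h4 => ((main p hp).2 v hv h1 h3 h4).2
  · intro p hp v hv h1 h3
    by_cases h4 : v = p
    · subst h4; exact (main v hp).1
    · have h5 := (main p hp).2 v hv h1 h3 h4
      have h6 := (main p hp).1
      rw [o_sum p]
      have e1 : orient (b p) v p = orient p (b p) v := o_rot _ _ _
      have e2 : orient v (al (pr p)) p = orient (al (pr p)) p v := (o_rot v _ _).symm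
      linarith [h5.1, h5.2]
  · intro q hq
    have hq1 := (hτ q hq).1
    have := (Finset.mem_filter.1 (hτB q hq)).2
    rcases hBmem _ hq1 q hq this with h | h
    · exact ⟨_, hq1, Or.inr h⟩
    · refine ⟨σ (τ q), (hσ _ hq1).1, Or.inl ?_⟩
      have h3 := hpr (σ (τ q)) (hσ _ hq1).1
      have : pr (σ (τ q)) = τ q := by
        have hinj := Finset.injOn_of_surjOn_of_card_le σ (s := ext (core S)) (t := ext (core S))
          (fun p hp => (hσ p hp).1) (fun r hr => by
            obtain ⟨p, hp, h⟩ := hσs r hr; exact ⟨p, hp, h⟩) le_rfl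
        exact hinj h3.1 hq1 h3.2
      rw [this]; exact h
  · intro p hp p' hp' h
    have h1 := hτa _ (hpr p hp).1
    have h3 := hτa _ (hpr p' hp').1
    rw [h, h3] at h1
    rw [← (hpr p hp).2, ← (hpr p' hp').2, h1]
  · intro p hp p' hp' h
    rw [← hτb p hp, h, hτb p' hp']
  · intro p hp p' hp' h
    have h1 := hτa _ (hpr p hp).1
    rw [h, hτb p' hp'] at h1
    have h3 := (hba p' hp').2
    rw [h1] at h3 h
    rw [← h] at h3
    exact o_ne23 h3 rfl

lemma ss_trans {x y z : ℝ} (h1 : 0 < x * y) (h2 : 0 < y * z) : 0 < x * z := by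
  have h3 := mul_pos h1 h2
  have hy : 0 < y * y := by
    rcases lt_trichotomy y 0 with h | h | h
    · exact mul_pos_of_neg_of_neg h h
    · subst h; simp at h1
    · exact mul_pos h h
  refine pos_of_mul_pos_right (a := y * y) ?_ hy.le
  linarith [show x * y * (y * z) = y * y * (x * z) by ring]

lemma ss_symm {x y : ℝ} (h : 0 < x * y) : 0 < y * x := by rwa [mul_comm]

/-- A block: a point of the second layer and its two children. -/
def Blk (a b : Pt → Pt) (p x : Pt) : Prop := x = a p ∨ x = b p ∨ x = p

lemma Blk.mem {S : Finset Pt} {a b : Pt → Pt} (hF : Fam S a b) {p x : Pt}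
    (hp : p ∈ ext (core S)) (hx : Blk a b p x) : x ∈ S := by
  rcases hx with rfl | rfl | rfl
  · exact ext_sub _ (hF.am _ hp)
  · exact ext_sub _ (hF.bm _ hp)
  · exact core_sub _ (ext_sub _ hp)

lemma Blk.disj {S : Finset Pt} {a b : Pt → Pt} (hF : Fam S a b) {p p' x : Pt}
    (hp : p ∈ ext (core S)) (hp' : p' ∈ ext (core S)) (hx : Blk a b p x) (hx' : Blk a b p' x) :
    p = p' := by
  have hpc := ext_sub _ hp
  have hpc' := ext_sub _ hp'
  rcases hx with rfl | rfl | rfl <;> rcases hx' with h | h | h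
  · exact hF.ia _ hp _ hp' h
  · exact absurd h (hF.ne _ hp _ hp')
  · exact absurd h (ext_ne_core (hF.am _ hp) hpc')
  · exact absurd h.symm (hF.ne _ hp' _ hp)
  · exact hF.ib _ hp _ hp' h
  · exact absurd h (ext_ne_core (hF.bm _ hp) hpc')
  · exact absurd h.symm (ext_ne_core (hF.am _ hp') hpc)
  · exact absurd h.symm (ext_ne_core (hF.bm _ hp') hpc)
  · exact h

lemma nblk {a b : Pt → Pt} {p x : Pt} (h : ¬ Blk a b p x) : x ≠ a p ∧ x ≠ b p ∧ x ≠ p :=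
  ⟨fun e => h (Or.inl e), fun e => h (Or.inr (Or.inl e)), fun e => h (Or.inr (Or.inr e))⟩

lemma comb_ss {p a b x w : Pt} (h : 0 < orient p a b) (h1 : 0 < orient p x b)
    (h2 : 0 < orient p a x) (h3 : 0 < orient p a w * orient p b w) :
    0 < orient p a w * orient p x w := by
  rcases pos_and_pos_or_neg_and_neg_of_mul_pos h3 with ⟨h4, h5⟩ | ⟨h4, h5⟩
  · exact mul_pos h4 (comb_pos h h1 h2 h4 h5)
  · exact mul_pos_of_neg_of_neg h4 (comb_neg h h1 h2 h4 h5)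

lemma blk_all {a b : Pt → Pt} {p x y : Pt} {f : Pt → ℝ} (h1 : 0 < f (a p) * f (b p))
    (h2 : 0 < f (a p) * f p) (hx : Blk a b p x) (hy : Blk a b p y) : 0 < f x * f y := by
  have k1 : 0 < f (a p) * f (a p) := ss_trans h1 (ss_symm h1)
  have k : ∀ z, Blk a b p z → 0 < f (a p) * f z := by
    rintro z (rfl | rfl | rfl)
    · exact k1
    · exact h1
    · exact h2
  exact ss_trans (ss_symm (k x hx)) (k y hy)

lemma fam_g1 {S : Finset Pt} (hS : GP S) (hA : AC S) {a b : Pt → Pt} (hF : Fam S a b) {p d v : Pt}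
    (hp : p ∈ ext (core S)) (hd : d ∈ ext S) (hdp : ¬ Blk a b p d) (hv : v ∈ S)
    (hvp : ¬ Blk a b p v) (hvd : v ≠ d) :
    0 < orient d (a p) v * orient d (b p) v ∧ 0 < orient d (a p) v * orient d p v := by
  obtain ⟨d1, d2, d3⟩ := nblk hdp
  obtain ⟨v1, v2, v3⟩ := nblk hvp
  have hdS := ext_sub _ hd
  have haS := ext_sub _ (hF.am p hp)
  have hbS := ext_sub _ (hF.bm p hp)
  have abd := hF.ab p hp d hdS d1 d2
  have abv := hF.ab p hp v hv v1 v2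
  have apd := hF.ap p hp d hdS d1 d2 d3
  have pbd := hF.pb p hp d hdS d1 d2 d3
  have abp := hF.abp p hp
  have hIp : InT (a p) (b p) d p := ⟨abp, by rw [o_rot]; exact pbd, by rw [o_rot2]; exact apd⟩
  have h1 : 0 < orient d (a p) v * orient d (b p) v := by
    rcases gp_or hS hdS haS hv d1 hvd.symm v1.symm with h | h <;>
    rcases gp_or hS hdS hbS hv d2 hvd.symm v2.symm with h' | h'
    · exact mul_pos h h'
    · exfalso
      have hIv : InT (a p) (b p) d v := ⟨abv, by rw [o_swap]; linarith, h⟩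
      rcases mem_or hv with hve | hvc
      · exact ext_not_InT hve haS hbS hdS hIv
      · exact v3 ((hA _ (hF.am p hp) _ (hF.bm p hp) d hd abd).unique ⟨hvc, hIv⟩
          ⟨ext_sub _ hp, hIp⟩)
    · exfalso
      exact ext_not_InT hd haS hbS hv ⟨abd, by rw [o_rot]; exact h', by
        rw [o_rot2, o_swap]; linarith⟩
    · exact mul_pos_of_neg_of_neg h h'
  refine ⟨h1, comb_ss ?_ ?_ ?_ h1⟩
  · rw [o_rot2]; exact abd
  · rw [o_rot2]; exact pbd
  · rw [o_rot2]; exact apd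

lemma fam_g2 {S : Finset Pt} (hS : GP S) (hA : AC S) {a b : Pt → Pt} (hF : Fam S a b)
    {p p' d v : Pt} (hp : p ∈ ext (core S)) (hp' : p' ∈ ext (core S)) (hpp : p ≠ p')
    (hd : Blk a b p' d) (hv : v ∈ S) (hvp : ¬ Blk a b p v) (hvp' : ¬ Blk a b p' v)
    {x y : Pt} (hx : Blk a b p x) (hy : Blk a b p y) : 0 < orient d x v * orient d y v := by
  obtain ⟨v1, v2, v3⟩ := nblk hvp
  obtain ⟨w1, w2, w3⟩ := nblk hvp'
  have hdp : ∀ d, Blk a b p' d → ¬ Blk a b p d := fun d h1 h2 => hpp (Blk.disj hF hp hp' h2 h1)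
  have hdp' : ∀ d, Blk a b p d → ¬ Blk a b p' d := fun d h1 h2 => hpp (Blk.disj hF hp hp' h1 h2)
  have pa : Blk a b p (a p) := Or.inl rfl
  have pb : Blk a b p (b p) := Or.inr (Or.inl rfl)
  have pa' : Blk a b p' (a p') := Or.inl rfl
  have pb' : Blk a b p' (b p') := Or.inr (Or.inl rfl)
  have pp' : Blk a b p' p' := Or.inr (Or.inr rfl)
  have ka := fam_g1 hS hA hF hp (hF.am p' hp') (hdp _ pa') hv hvp w1
  have kb := fam_g1 hS hA hF hp (hF.bm p' hp') (hdp _ pb') hv hvp w2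
  rcases hd with rfl | rfl | rfl
  · exact blk_all (f := fun x => orient (a p') x v) ka.1 ka.2 hx hy
  · exact blk_all (f := fun x => orient (b p') x v) kb.1 kb.2 hx hy
  · have la := fam_g1 hS hA hF hp' (hF.am p hp) (hdp' _ pa) hv hvp' v1
    have lb := fam_g1 hS hA hF hp' (hF.bm p hp) (hdp' _ pb) hv hvp' v2
    have e1 : 0 < orient d (a p) v * orient d (b p) v := by
      have h1 := la.2
      have h2 := lb.2
      have h3 := ka.1
      rw [o_swap (a p) d, o_swap (b p) d]
      rw [o_swap (a p) (a d), o_swap (b p) (a d)] at h3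
      have h4 : 0 < orient (a p) (a d) v * orient (b p) (a d) v := by linarith
      have := ss_trans (ss_symm h1) (ss_trans h4 h2)
      linarith
    have hdS := Blk.mem hF hp' pp'
    obtain ⟨d1, d2, d3⟩ := nblk (hdp _ pp')
    have e2 : 0 < orient d (a p) v * orient d p v := by
      refine comb_ss ?_ ?_ ?_ e1
      · rw [o_rot2]; exact hF.ab p hp d hdS d1 d2
      · rw [o_rot2]; exact hF.pb p hp d hdS d1 d2 d3
      · rw [o_rot2]; exact hF.ap p hp d hdS d1 d2 d3
    exact blk_all (f := fun x => orient d x v) e1 e2 hx hy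

lemma split_filter (S : Finset Pt) (P : Pt → Prop) :
    (S.filter P).card = ((ext S).filter P).card + ((core S).filter P).card := by
  rw [← Finset.card_union_of_disjoint]
  · congr 1
    ext1 w
    simp only [Finset.mem_union, Finset.mem_filter]
    constructor
    · rintro ⟨h1, h2⟩
      rcases mem_or h1 with h | h
      · exact Or.inl ⟨h, h2⟩
      · exact Or.inr ⟨h, h2⟩
    · rintro (⟨h1, h2⟩ | ⟨h1, h2⟩)
      · exact ⟨ext_sub _ h1, h2⟩
      · exact ⟨core_sub _ h1, h2⟩
  · rw [Finset.disjoint_left]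
    intro w h1 h2
    exact ext_ne_core (Finset.mem_filter.1 h1).1 (Finset.mem_filter.1 h2).1 rfl

lemma parity {S : Finset Pt} (hS : GP S) (hA : AC S) (hA' : AC (core S)) {u v p : Pt}
    (hu : u ∈ core (core S)) (hv : v ∈ core (core S)) (huv : u ≠ v) (hp : p ∈ ext (core S))
    (h : ∀ x ∈ ext S, (0 < orient u v x ↔ 0 < orient u p x)) : False := by
  have hI : GP (core S) := hS.mono (core_sub S)
  have h1 := cl1 hS hA (core_sub _ hu) (core_sub _ hv) huv
  have h2 := cl1 hI hA' hu hv huv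
  have h3 := cl1 hS hA (core_sub _ hu) (ext_sub _ hp) (ext_ne_core hp hu).symm
  have h4 := cl2 hI hA' hu hp
  rw [split_filter (core S)] at h1 h3
  rw [Finset.filter_congr h] at h1
  omega

lemma fam_g3a {S : Finset Pt} (hS : GP S) (hA : AC S) (hA' : AC (core S)) {a b : Pt → Pt}
    (hF : Fam S a b) {u v p : Pt}
    (hu : u ∈ core (core S)) (hv : v ∈ core (core S)) (huv : u ≠ v) (hp : p ∈ ext (core S)) :
    (0 < orient u v p → 0 < orient u v (a p)) ∧ (orient u v p < 0 → orient u v (b p) < 0) := by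
  have huS := core_sub _ (core_sub _ hu)
  have hvS := core_sub _ (core_sub _ hv)
  have haE := hF.am p hp
  have hbE := hF.bm p hp
  have u1 : u ≠ a p := (ext_ne_core haE (core_sub _ hu)).symm
  have u2 : u ≠ b p := (ext_ne_core hbE (core_sub _ hu)).symm
  have u3 : u ≠ p := (ext_ne_core hp hu).symm
  have v1 : v ≠ a p := (ext_ne_core haE (core_sub _ hv)).symm
  have v2 : v ≠ b p := (ext_ne_core hbE (core_sub _ hv)).symm
  have hub : ¬ Blk a b p u := by rintro (h | h | h); exacts [u1 h, u2 h, u3 h]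
  have o1 : 0 < orient u (a p) p := by rw [o_rot2]; exact hF.ap p hp u huS u1 u2 u3
  have o2 : 0 < orient u p (b p) := by rw [o_rot2]; exact hF.pb p hp u huS u1 u2 u3
  have o3 : 0 < orient u (a p) (b p) := by rw [o_rot2]; exact hF.ab p hp u huS u1 u2
  have hx : ∀ x ∈ ext S, x ≠ a p → x ≠ b p → 0 < orient u (a p) x * orient u (b p) x ∧
      0 < orient u (a p) x * orient u p x := by
    intro x hxE h1 h2
    have h3 : x ≠ p := ext_ne_core hxE (ext_sub _ hp)
    have h4 := fam_g1 hS hA hF hp hxE (by rintro (h | h | h); exacts [h1 h, h2 h, h3 h]) huS hub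
      (ext_ne_core hxE (core_sub _ hu)).symm
    rw [o_swap3 u (a p) x, o_swap3 u (b p) x, o_swap3 u p x] at h4
    constructor
    · linarith [h4.1]
    · linarith [h4.2]
  constructor
  · intro h
    rcases gp_or hS huS hvS (ext_sub _ haE) huv u1 v1 with h' | h'
    · exact h'
    exfalso
    have o4 : 0 < orient u (a p) v := by rw [o_swap2]; linarith
    refine parity hS hA hA' hu hv huv hp ?_
    intro x hxE
    by_cases hxa : x = a p
    · subst hxa
      have : orient u p (a p) < 0 := by rw [o_swap2]; linarith
      constructor <;> intro _ <;> linarith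
    by_cases hxb : x = b p
    · subst hxb
      exact ⟨fun _ => o2, fun _ => comb_pos o1 h o4 o3 o2⟩
    obtain ⟨k1, k2⟩ := hx x hxE hxa hxb
    rcases pos_and_pos_or_neg_and_neg_of_mul_pos k2 with ⟨h4, h5⟩ | ⟨h4, h5⟩
    · exact ⟨fun _ => h5, fun _ => comb_pos o1 h o4 h4 h5⟩
    · have := comb_neg o1 h o4 h4 h5
      constructor <;> intro _ <;> linarith
  · intro h
    rcases gp_or hS huS hvS (ext_sub _ hbE) huv u2 v2 with h' | h'
    swap
    · exact h'
    exfalso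
    have o4 : 0 < orient u p v := by rw [o_swap2]; linarith
    have o5 : orient u p (a p) < 0 := by rw [o_swap2]; linarith
    have o6 : orient u (b p) (a p) < 0 := by rw [o_swap2]; linarith
    refine parity hS hA hA' hu hv huv hp ?_
    intro x hxE
    by_cases hxa : x = a p
    · subst hxa
      have := comb_neg o2 h' o4 o5 o6
      constructor <;> intro _ <;> linarith
    by_cases hxb : x = b p
    · subst hxb
      exact ⟨fun _ => o2, fun _ => h'⟩
    obtain ⟨k1, k2⟩ := hx x hxE hxa hxb
    have k3 := ss_trans (ss_symm k2) k1
    rcases pos_and_pos_or_neg_and_neg_of_mul_pos k3 with ⟨h4, h5⟩ | ⟨h4, h5⟩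
    · exact ⟨fun _ => h4, fun _ => comb_pos o2 h' o4 h4 h5⟩
    · have := comb_neg o2 h' o4 h4 h5
      constructor <;> intro _ <;> linarith

lemma fam_g3 {S : Finset Pt} (hS : GP S) (hA : AC S) (hA' : AC (core S)) {a b : Pt → Pt}
    (hF : Fam S a b) {u v p q : Pt} (hu : u ∈ core (core S)) (hv : v ∈ core (core S)) (huv : u ≠ v)
    (hp : p ∈ ext (core S)) (hq : Blk a b p q) : 0 < orient u v q * orient u v p := by
  have h1 := fam_g3a hS hA hA' hF hu hv huv hp
  have h2 := fam_g3a hS hA hA' hF hv hu huv.symm hp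
  rw [o_swap u v p, o_swap u v (a p), o_swap u v (b p)] at h2
  rcases gp_or hS (core_sub _ (core_sub _ hu)) (core_sub _ (core_sub _ hv))
    (core_sub _ (ext_sub _ hp)) huv (ext_ne_core hp hu).symm (ext_ne_core hp hv).symm with h | h
  · have e1 := h1.1 h
    have e2 := h2.2 (by linarith)
    rcases hq with rfl | rfl | rfl
    · exact mul_pos e1 h
    · exact mul_pos (by linarith) h
    · exact mul_pos h h
  · have e1 := h1.2 h
    have e2 := h2.1 (by linarith)
    rcases hq with rfl | rfl | rfl
    · exact mul_pos_of_neg_of_neg (by linarith) h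
    · exact mul_pos_of_neg_of_neg e1 h
    · exact mul_pos_of_neg_of_neg h h

lemma blk_or {S : Finset Pt} {a b : Pt → Pt} (hF : Fam S a b) {x : Pt} (hx : x ∈ S) :
    x ∈ core (core S) ∨ ∃ p ∈ ext (core S), Blk a b p x := by
  rcases mem_or hx with h | h
  · obtain ⟨p, hp, h⟩ := hF.cov x h
    exact Or.inr ⟨p, hp, h.elim Or.inl (fun h => Or.inr (Or.inl h))⟩
  · rcases mem_or h with h | h
    · exact Or.inr ⟨x, h, Or.inr (Or.inr rfl)⟩
    · exact Or.inl h

lemma fam_g {S : Finset Pt} (hS : GP S) (hA : AC S) (hA' : AC (core S)) {a b : Pt → Pt}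
    (hF : Fam S a b) {u v p q : Pt} (hu : u ∈ S) (hv : v ∈ S) (huv : u ≠ v)
    (hp : p ∈ ext (core S)) (hq : Blk a b p q) (hup : ¬ Blk a b p u) (hvp : ¬ Blk a b p v)
    (huvb : ∀ r ∈ ext (core S), ¬ (Blk a b r u ∧ Blk a b r v)) :
    0 < orient q u v * orient p u v := by
  rcases blk_or hF hu with hu' | ⟨r, hr, hru⟩
  · rcases blk_or hF hv with hv' | ⟨r, hr, hrv⟩
    · have := fam_g3 hS hA hA' hF hu' hv' huv hp hq
      rwa [← o_rot q u v, ← o_rot p u v]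
    · have hpr : p ≠ r := by rintro rfl; exact hvp hrv
      have := fam_g2 hS hA hF hp hr hpr hrv hu hup (fun h => huvb r hr ⟨h, hrv⟩) hq
        (Or.inr (Or.inr rfl))
      rwa [o_rot2 q u v, o_rot2 p u v] at this
  · have hpr : p ≠ r := by rintro rfl; exact hup hru
    have := fam_g2 hS hA hF hp hr hpr hru hv hvp (fun h => huvb r hr ⟨hru, h⟩) hq
      (Or.inr (Or.inr rfl))
    rw [o_swap q u, o_swap p u] at this
    linarith

def Hered (S : Finset Pt) : Prop := GP S ∧ ∀ i, AC (core^[i] S)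

lemma Hered.core {S : Finset Pt} (h : Hered S) : Hered (core S) :=
  ⟨h.1.mono (core_sub S), fun i => h.2 (i + 1)⟩

/-- compare orientations in the set and in the drawing. -/
def DD (l : Pt → List Bool) (x y z : Pt) : ℝ :=
  orient x y z * orient (yy (l x)) (yy (l y)) (yy (l z))

lemma DD_rot (l : Pt → List Bool) (x y z : Pt) : DD l y z x = DD l x y z := by
  unfold DD; rw [o_rot x y z, o_rot (yy (l x)) (yy (l y)) (yy (l z))]

lemma DD_swap (l : Pt → List Bool) (x y z : Pt) : DD l y x z = DD l x y z := by
  unfold DD; rw [o_swap, o_swap (yy (l x))]; ring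

lemma DD_all {l : Pt → List Bool} {x y z : Pt} (h : 0 < DD l x y z) :
    0 < DD l y z x ∧ 0 < DD l z x y ∧ 0 < DD l y x z ∧ 0 < DD l x z y ∧ 0 < DD l z y x := by
  have h1 : 0 < DD l y z x := by rwa [DD_rot]
  have h2 : 0 < DD l z x y := by rwa [DD_rot]
  exact ⟨h1, h2, by rwa [DD_swap], by rwa [DD_swap], by rwa [DD_swap]⟩

structure Lab (S : Finset Pt) (l : Pt → List Bool) (j : ℕ) : Prop where
  inj : ∀ x ∈ S, ∀ y ∈ S, l x = l y → x = y
  le : ∀ x ∈ S, (l x).length ≤ j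
  eq : ∀ x ∈ ext S, (l x).length = j
  card : 2 ^ j ≤ 2 * S.card
  pos : ∀ x ∈ S, ∀ y ∈ S, ∀ z ∈ S, x ≠ y → x ≠ z → y ≠ z → 0 < DD l x y z

lemma card_S (S : Finset Pt) : (core S).card + (ext S).card = S.card :=
  Finset.card_sdiff_add_card_eq_card (ext_sub _)

lemma base0 {S : Finset Pt} (hH : Hered S) (hne : S.Nonempty) (hc : core S = ∅) :
    ∃ l j, Lab S l j := by
  have he : ext S = S := by
    apply Finset.Subset.antisymm (ext_sub S)
    intro x hx
    rcases mem_or hx with h | h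
    · exact h
    · rw [hc] at h; simp at h
  have hA : AC S := hH.2 0
  have h2 : S.card ≤ 2 := by
    by_contra hh
    obtain ⟨a, b, c, ha, hb, hc', hab, hac, hbc⟩ := Finset.two_lt_card_iff.1 (not_le.1 hh)
    have ea : a ∈ ext S := by rw [he]; exact ha
    have eb : b ∈ ext S := by rw [he]; exact hb
    have ec : c ∈ ext S := by rw [he]; exact hc'
    rcases gp_or hH.1 ha hb hc' hab hac hbc with h | h
    · obtain ⟨p, hp, -⟩ := hA a ea b eb c ec h
      rw [hc] at hp; simp at hp
    · obtain ⟨p, hp, -⟩ := hA b eb a ea c ec (by rw [o_swap]; linarith)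
      rw [hc] at hp; simp at hp
  have hpos : ∀ l : Pt → List Bool, ∀ x ∈ S, ∀ y ∈ S, ∀ z ∈ S, x ≠ y → x ≠ z → y ≠ z →
      0 < DD l x y z := by
    intro l x hx y hy z hz h1 h3 h4
    have := Finset.two_lt_card_iff.2 ⟨x, y, z, hx, hy, hz, h1, h3, h4⟩
    omega
  have h1 : 1 ≤ S.card := Finset.card_pos.2 hne
  rcases (show S.card = 1 ∨ S.card = 2 by omega) with h | h
  · obtain ⟨x, rfl⟩ := Finset.card_eq_one.1 h
    refine ⟨fun _ => [], 0, ?_, ?_, ?_, ?_, hpos _⟩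
    · intro a ha b hb _
      rw [Finset.mem_singleton.1 ha, Finset.mem_singleton.1 hb]
    · simp
    · simp
    · simp
  · obtain ⟨x, y, hxy, rfl⟩ := Finset.card_eq_two.1 h
    refine ⟨fun w => if w = x then [false] else [true], 1, ?_, ?_, ?_, ?_, hpos _⟩
    · intro a ha b hb hab
      simp only [Finset.mem_insert, Finset.mem_singleton] at ha hb
      rcases ha with rfl | rfl <;> rcases hb with rfl | rfl
      · rfl
      · simp [hxy.symm] at hab
      · simp [hxy.symm] at hab
      · rfl
    · intro w _; split_ifs <;> simp
    · intro w _; split_ifs <;> simp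
    · rw [h]; norm_num

lemma base1 {S : Finset Pt} (hH : Hered S) (hc : (core S).card = 1) :
    ∃ l j, Lab S l j := by
  have hA : AC S := hH.2 0
  obtain ⟨c, hcc⟩ := Finset.card_eq_one.1 hc
  have hcm : c ∈ core S := by rw [hcc]; simp
  have h3 := card_ext hH.1 hA ⟨c, hcm⟩
  rw [hc] at h3
  have hSc := card_S S
  have hex : ∃ x y z, ext S = {x, y, z} ∧ 0 < orient x y z := by
    obtain ⟨x, y, z, hxy, hxz, hyz, he⟩ := Finset.card_eq_three.1 h3
    have hx : x ∈ S := ext_sub S (by rw [he]; simp)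
    have hy : y ∈ S := ext_sub S (by rw [he]; simp)
    have hz : z ∈ S := ext_sub S (by rw [he]; simp)
    rcases gp_or hH.1 hx hy hz hxy hxz hyz with h | h
    · exact ⟨x, y, z, he, h⟩
    · exact ⟨y, x, z, by rw [he, Finset.insert_comm], by rw [o_swap]; linarith⟩
  obtain ⟨x, y, z, he, hxyz⟩ := hex
  have hx : x ∈ ext S := by rw [he]; simp
  have hy : y ∈ ext S := by rw [he]; simp
  have hz : z ∈ ext S := by rw [he]; simp
  obtain ⟨c', ⟨hc1, hc2⟩, -⟩ := hA x hx y hy z hz hxyz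
  have : c' = c := by rw [hcc] at hc1; exact Finset.mem_singleton.1 hc1
  subst this
  have hxy := o_ne12 hxyz
  have hxz := o_ne13 hxyz
  have hyz := o_ne23 hxyz
  have hxc := ext_ne_core hx hc1
  have hyc := ext_ne_core hy hc1
  have hzc := ext_ne_core hz hc1
  set l : Pt → List Bool := fun w => if w = c' then [false] else if w = x then [false, false]
    else if w = y then [false, true] else [true, false] with hl
  have lc : l c' = [false] := by simp [hl]
  have lx : l x = [false, false] := by simp [hl, hxc]
  have ly : l y = [false, true] := by simp [hl, hyc, hxy.symm]
  have lz : l z = [true, false] := by simp [hl, hzc, hxz.symm, hyz.symm]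
  have hmem : ∀ w ∈ S, w = c' ∨ w = x ∨ w = y ∨ w = z := by
    intro w hw
    rcases mem_or hw with h | h
    · rw [he] at h; simp at h; exact Or.inr h
    · rw [hcc] at h; exact Or.inl (Finset.mem_singleton.1 h)
  have yv := ya [false] [true, false] (by simp)
  have ys := ya_self [false]
  simp only [List.cons_append, List.nil_append] at yv ys
  have p1 : 0 < DD l x y z := by
    unfold DD; rw [lx, ly, lz]; exact mul_pos hxyz yv.2.2
  have p2 : 0 < DD l x y c' := by
    unfold DD; rw [lx, ly, lc]; exact mul_pos hc2.1 ys
  have p3 : 0 < DD l y z c' := by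
    unfold DD; rw [ly, lz, lc]; exact mul_pos hc2.2.1 (by rw [o_rot]; exact yv.2.1)
  have p4 : 0 < DD l z x c' := by
    unfold DD; rw [lz, lx, lc]; exact mul_pos hc2.2.2 (by rw [o_rot2]; exact yv.1)
  obtain ⟨a1, a2, a3, a4, a5⟩ := DD_all p1
  obtain ⟨b1, b2, b3, b4, b5⟩ := DD_all p2
  obtain ⟨c1, c2, c3, c4, c5⟩ := DD_all p3
  obtain ⟨d1, d2, d3, d4, d5⟩ := DD_all p4
  refine ⟨l, 2, ?_, ?_, ?_, ?_, ?_⟩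
  · intro u hu v hv h
    rcases hmem u hu with hu | hu | hu | hu <;> rcases hmem v hv with hv | hv | hv | hv <;>
      rw [hu, hv] at h ⊢ <;> first | rfl | (simp [lc, lx, ly, lz] at h)
  · intro u hu
    rcases hmem u hu with hu | hu | hu | hu <;> rw [hu] <;> simp [lc, lx, ly, lz]
  · intro u hu
    rw [he] at hu
    simp only [Finset.mem_insert, Finset.mem_singleton] at hu
    rcases hu with hu | hu | hu <;> rw [hu] <;> simp [lx, ly, lz]
  · omega
  · intro u hu v hv w hw huv huw hvw
    rcases hmem u hu with hu | hu | hu | hu <;> rcases hmem v hv with hv | hv | hv | hv <;>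
    rcases hmem w hw with hw | hw | hw | hw <;> rw [hu, hv] at huv <;> rw [hu, hw] at huw <;>
    rw [hv, hw] at hvw <;> rw [hu, hv, hw] <;> first | contradiction | assumption

lemma lab_step {S : Finset Pt} (hH : Hered S) (h2 : 2 ≤ (core S).card) {l0 : Pt → List Bool} {j : ℕ}
    (hL : Lab (core S) l0 j) : ∃ l, Lab S l (j + 1) := by
  have hS := hH.1
  have hA : AC S := hH.2 0
  have hA' : AC (core S) := hH.2 1
  obtain ⟨a, b, hF⟩ := fam_exists hS hA hA' h2
  have hl : ∀ x, ∃ m : List Bool, (x ∈ core S → m = l0 x) ∧ (∀ p ∈ ext (core S),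
      (x = a p → m = l0 p ++ [false]) ∧ (x = b p → m = l0 p ++ [true])) := by
    intro x
    by_cases hx : x ∈ core S
    · refine ⟨l0 x, fun _ => rfl, fun p hp => ⟨fun h => ?_, fun h => ?_⟩⟩
      · exact absurd h.symm (ext_ne_core (hF.am p hp) hx)
      · exact absurd h.symm (ext_ne_core (hF.bm p hp) hx)
    by_cases hxa : ∃ p ∈ ext (core S), x = a p
    · obtain ⟨p, hp, h⟩ := hxa
      refine ⟨l0 p ++ [false], fun h => absurd h hx, fun p' hp' => ⟨fun h' => ?_, fun h' => ?_⟩⟩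
      · rw [hF.ia p hp p' hp' (h.symm.trans h')]
      · exact absurd (h.symm.trans h') (hF.ne p hp p' hp')
    by_cases hxb : ∃ p ∈ ext (core S), x = b p
    · obtain ⟨p, hp, h⟩ := hxb
      refine ⟨l0 p ++ [true], fun h => absurd h hx, fun p' hp' => ⟨fun h' => ?_, fun h' => ?_⟩⟩
      · exact absurd (h'.symm.trans h) (hF.ne p' hp' p hp)
      · rw [hF.ib p hp p' hp' (h.symm.trans h')]
    · exact ⟨[], fun h => absurd h hx, fun p hp => ⟨fun h => absurd ⟨p, hp, h⟩ hxa,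
        fun h => absurd ⟨p, hp, h⟩ hxb⟩⟩
  choose l hl using hl
  have lc : ∀ x ∈ core S, l x = l0 x := fun x hx => (hl x).1 hx
  have la : ∀ p ∈ ext (core S), l (a p) = l p ++ [false] := fun p hp => by
    rw [((hl (a p)).2 p hp).1 rfl, lc p (ext_sub _ hp)]
  have lb : ∀ p ∈ ext (core S), l (b p) = l p ++ [true] := fun p hp => by
    rw [((hl (b p)).2 p hp).2 rfl, lc p (ext_sub _ hp)]
  have lj : ∀ p ∈ ext (core S), (l p).length = j := fun p hp => by
    rw [lc p (ext_sub _ hp)]; exact hL.eq p hp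
  have linj : ∀ x ∈ core S, ∀ y ∈ core S, l x = l y → x = y := by
    intro x hx y hy h
    rw [lc x hx, lc y hy] at h
    exact hL.inj x hx y hy h
  have pre : ∀ p ∈ ext (core S), ∀ x ∈ S, l p <+: l x → Blk a b p x := by
    intro p hp x hx h
    have key : ∀ r ∈ ext (core S), ∀ t, l p <+: l r ++ t → p = r := by
      intro r hr t ht
      have h1 := List.prefix_of_prefix_length_le ht (List.prefix_append (l r) t)
        (by rw [lj p hp, lj r hr])
      exact linj p (ext_sub _ hp) r (ext_sub _ hr) (h1.eq_of_length (by rw [lj p hp, lj r hr]))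
    rcases mem_or hx with hx | hx
    · obtain ⟨r, hr, rfl | rfl⟩ := hF.cov x hx
      · rw [la r hr] at h
        rw [key r hr _ h]; exact Or.inl rfl
      · rw [lb r hr] at h
        rw [key r hr _ h]; exact Or.inr (Or.inl rfl)
    · have h1 : (l x).length ≤ j := by rw [lc x hx]; exact hL.le x hx
      have h3 := h.eq_of_length_le (by rw [lj p hp]; exact h1)
      exact Or.inr (Or.inr (linj p (ext_sub _ hp) x hx h3).symm)
  have pre2 : ∀ p ∈ ext (core S), ∀ x, Blk a b p x → l p <+: l x := by
    rintro p hp x (rfl | rfl | rfl)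
    · rw [la p hp]; exact List.prefix_append _ _
    · rw [lb p hp]; exact List.prefix_append _ _
    · exact List.prefix_rfl
  have coreS : ∀ x ∈ core S, x ∈ S := fun x hx => core_sub _ hx
  have eS : ∀ p ∈ ext (core S), p ∈ S := fun x hx => core_sub _ (ext_sub _ hx)
  have aS : ∀ p ∈ ext (core S), a p ∈ S := fun x hx => ext_sub _ (hF.am x hx)
  have bS : ∀ p ∈ ext (core S), b p ∈ S := fun x hx => ext_sub _ (hF.bm x hx)
  have inj : ∀ x ∈ S, ∀ y ∈ S, l x = l y → x = y := by
    have h1 : ∀ p ∈ ext (core S), ∀ x ∈ S, ∀ y ∈ S, Blk a b p x → l x = l y → x = y := by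
      intro p hp x hx y hy hxp he
      have hyp := pre p hp y hy (he ▸ pre2 p hp x hxp)
      have e1 := la p hp
      have e2 := lb p hp
      rcases hxp with rfl | rfl | rfl <;> rcases hyp with rfl | rfl | rfl <;>
        first | rfl | (exfalso; simp [e1, e2] at he)
    intro x hx y hy he
    rcases blk_or hF hx with hx' | ⟨p, hp, hb⟩
    · rcases blk_or hF hy with hy' | ⟨p, hp, hb⟩
      · exact linj x (core_sub _ hx') y (core_sub _ hy') he
      · exact (h1 p hp y hy x hx hb he.symm).symm
    · exact h1 p hp x hx y hy hb he
  -- triples with two points in the same block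
  have same : ∀ p ∈ ext (core S), ∀ x ∈ S, ∀ y ∈ S, ∀ z ∈ S, x ≠ y → x ≠ z → y ≠ z →
      Blk a b p x → Blk a b p y → 0 < DD l x y z := by
    intro p hp x hx y hy z hz hxy hxz hyz hbx hby
    have k0 : 0 < DD l (a p) (b p) p := by
      unfold DD; rw [la p hp, lb p hp]; exact mul_pos (hF.abp p hp) (ya_self _)
    obtain ⟨k1, k2, k3, k4, k5⟩ := DD_all k0
    by_cases hbz : Blk a b p z
    · rcases hbx with hx' | hx' | hx' <;> rcases hby with hy' | hy' | hy' <;>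
      rcases hbz with hz' | hz' | hz' <;> rw [hx', hy'] at hxy <;> rw [hx', hz'] at hxz <;>
      rw [hy', hz'] at hyz <;> rw [hx', hy', hz'] <;> first | contradiction | assumption
    · obtain ⟨z1, z2, z3⟩ := nblk hbz
      have hY := ya (l p) (l z) (fun h => hbz (pre p hp z hz h))
      have m1 : 0 < DD l (a p) p z := by
        unfold DD; rw [la p hp]; exact mul_pos (hF.ap p hp z hz z1 z2 z3) hY.1
      have m2 : 0 < DD l p (b p) z := by
        unfold DD; rw [lb p hp]; exact mul_pos (hF.pb p hp z hz z1 z2 z3) hY.2.1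
      have m3 : 0 < DD l (a p) (b p) z := by
        unfold DD; rw [la p hp, lb p hp]; exact mul_pos (hF.ab p hp z hz z1 z2) hY.2.2
      have n1 : 0 < DD l p (a p) z := (DD_all m1).2.2.1
      have n2 : 0 < DD l (b p) p z := (DD_all m2).2.2.1
      have n3 : 0 < DD l (b p) (a p) z := (DD_all m3).2.2.1
      rcases hbx with hx' | hx' | hx' <;> rcases hby with hy' | hy' | hy' <;>
      rw [hx', hy'] at hxy <;> rw [hx', hy'] <;> first | contradiction | assumption
  -- triples with no two points in the same block
  have red : ∀ x ∈ S, ∀ y ∈ S, ∀ z ∈ S, x ≠ y → x ≠ z → y ≠ z →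
      (∀ r ∈ ext (core S), ¬ (Blk a b r x ∧ Blk a b r y)) →
      (∀ r ∈ ext (core S), ¬ (Blk a b r x ∧ Blk a b r z)) →
      (∀ r ∈ ext (core S), ¬ (Blk a b r y ∧ Blk a b r z)) →
      (∀ x' ∈ core S, x' ≠ y → x' ≠ z →
        (∀ r ∈ ext (core S), ¬ (Blk a b r x' ∧ Blk a b r y)) →
        (∀ r ∈ ext (core S), ¬ (Blk a b r x' ∧ Blk a b r z)) → 0 < DD l x' y z) →
      0 < DD l x y z := by
    intro x hx y hy z hz hxy hxz hyz nxy nxz nyz hyp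
    rcases mem_or hx with hxe | hxc
    swap
    · exact hyp x hxc hxy hxz nxy nxz
    obtain ⟨p, hp, hxp⟩ := hF.cov x hxe
    have hbx : Blk a b p x := hxp.elim Or.inl (fun h => Or.inr (Or.inl h))
    have hyp' : ¬ Blk a b p y := fun h => nxy p hp ⟨hbx, h⟩
    have hzp' : ¬ Blk a b p z := fun h => nxz p hp ⟨hbx, h⟩
    have hpp : Blk a b p p := Or.inr (Or.inr rfl)
    have h1 := hyp p (ext_sub _ hp) (nblk hyp').2.2.symm (nblk hzp').2.2.symm
      (fun r hr h => by
        have := Blk.disj hF hp hr hpp h.1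
        subst this; exact hyp' h.2)
      (fun r hr h => by
        have := Blk.disj hF hp hr hpp h.1
        subst this; exact hzp' h.2)
    have h3 := fam_g hS hA hA' hF hy hz hyz hp hbx hyp' hzp' nyz
    have h4 : 0 < orient (yy (l x)) (yy (l y)) (yy (l z)) *
        orient (yy (l p)) (yy (l y)) (yy (l z)) := by
      have ny := fun h => hyp' (pre p hp y hy h)
      have nz := fun h => hzp' (pre p hp z hz h)
      have nyz' : l y ≠ l z := fun h => hyz (inj y hy z hz h)
      rcases hxp with h | h
      · rw [h, la p hp]; exact yiv _ _ _ _ ny nz nyz'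
      · rw [h, lb p hp]; exact yiv _ _ _ _ ny nz nyz'
    unfold DD at h1 ⊢
    have h5 := mul_pos h3 h4
    refine pos_of_mul_pos_left (b := orient p y z * orient (yy (l p)) (yy (l y)) (yy (l z))) ?_ h1.le
    linarith
  have symmN : ∀ {x y : Pt}, (∀ r ∈ ext (core S), ¬ (Blk a b r x ∧ Blk a b r y)) →
      (∀ r ∈ ext (core S), ¬ (Blk a b r y ∧ Blk a b r x)) := fun h r hr k => h r hr ⟨k.2, k.1⟩
  have cl_0 : ∀ x ∈ core S, ∀ y ∈ core S, ∀ z ∈ core S, x ≠ y → x ≠ z → y ≠ z → 0 < DD l x y z := by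
    intro x hx y hy z hz h1 h3 h4
    have := hL.pos x hx y hy z hz h1 h3 h4
    unfold DD at this ⊢
    rwa [lc x hx, lc y hy, lc z hz]
  have cl_1 : ∀ x ∈ S, ∀ y ∈ core S, ∀ z ∈ core S, x ≠ y → x ≠ z → y ≠ z →
      (∀ r ∈ ext (core S), ¬ (Blk a b r x ∧ Blk a b r y)) →
      (∀ r ∈ ext (core S), ¬ (Blk a b r x ∧ Blk a b r z)) →
      (∀ r ∈ ext (core S), ¬ (Blk a b r y ∧ Blk a b r z)) → 0 < DD l x y z := by
    intro x hx y hy z hz h1 h3 h4 n1 n2 n3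
    refine red x hx y (coreS y hy) z (coreS z hz) h1 h3 h4 n1 n2 n3 ?_
    intro x' hx' e1 e2 _ _
    exact cl_0 x' hx' y hy z hz e1 e2 h4
  have cl_2 : ∀ x ∈ S, ∀ y ∈ S, ∀ z ∈ core S, x ≠ y → x ≠ z → y ≠ z →
      (∀ r ∈ ext (core S), ¬ (Blk a b r x ∧ Blk a b r y)) →
      (∀ r ∈ ext (core S), ¬ (Blk a b r x ∧ Blk a b r z)) →
      (∀ r ∈ ext (core S), ¬ (Blk a b r y ∧ Blk a b r z)) → 0 < DD l x y z := by
    intro x hx y hy z hz h1 h3 h4 n1 n2 n3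
    refine red x hx y hy z (coreS z hz) h1 h3 h4 n1 n2 n3 ?_
    intro x' hx' e1 e2 m1 m2
    rw [← DD_rot]
    exact cl_1 y hy z hz x' hx' h4 e1.symm e2.symm n3 (symmN m1) (symmN m2)
  have cl_3 : ∀ x ∈ S, ∀ y ∈ S, ∀ z ∈ S, x ≠ y → x ≠ z → y ≠ z →
      (∀ r ∈ ext (core S), ¬ (Blk a b r x ∧ Blk a b r y)) →
      (∀ r ∈ ext (core S), ¬ (Blk a b r x ∧ Blk a b r z)) →
      (∀ r ∈ ext (core S), ¬ (Blk a b r y ∧ Blk a b r z)) → 0 < DD l x y z := by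
    intro x hx y hy z hz h1 h3 h4 n1 n2 n3
    refine red x hx y hy z hz h1 h3 h4 n1 n2 n3 ?_
    intro x' hx' e1 e2 m1 m2
    rw [← DD_rot]
    exact cl_2 y hy z hz x' hx' h4 e1.symm e2.symm n3 (symmN m1) (symmN m2)
  refine ⟨l, inj, ?_, ?_, ?_, ?_⟩
  · intro x hx
    rcases mem_or hx with hx | hx
    · obtain ⟨p, hp, rfl | rfl⟩ := hF.cov x hx
      · rw [la p hp]; simp [lj p hp]
      · rw [lb p hp]; simp [lj p hp]
    · rw [lc x hx]; exact (hL.le x hx).trans (Nat.le_succ j)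
  · intro x hx
    obtain ⟨p, hp, rfl | rfl⟩ := hF.cov x hx
    · rw [la p hp]; simp [lj p hp]
    · rw [lb p hp]; simp [lj p hp]
  · have h1 := card_ext hS hA (Finset.card_pos.1 (by omega))
    have h3 := card_S S
    have h4 := hL.card
    rw [pow_succ]; omega
  · intro x hx y hy z hz h1 h3 h4
    by_cases n1 : ∃ r ∈ ext (core S), Blk a b r x ∧ Blk a b r y
    · obtain ⟨r, hr, e1, e2⟩ := n1
      exact same r hr x hx y hy z hz h1 h3 h4 e1 e2
    by_cases n2 : ∃ r ∈ ext (core S), Blk a b r x ∧ Blk a b r z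
    · obtain ⟨r, hr, e1, e2⟩ := n2
      exact (DD_all (same r hr x hx z hz y hy h3 h1 h4.symm e1 e2)).2.2.2.1
    by_cases n3 : ∃ r ∈ ext (core S), Blk a b r y ∧ Blk a b r z
    · obtain ⟨r, hr, e1, e2⟩ := n3
      exact (DD_all (same r hr y hy z hz x hx h4 h1.symm h3.symm e1 e2)).2.1
    push Not at n1 n2 n3
    exact cl_3 x hx y hy z hz h1 h3 h4 (fun r hr h => n1 r hr h.1 h.2)
      (fun r hr h => n2 r hr h.1 h.2) (fun r hr h => n3 r hr h.1 h.2)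

lemma lab_exists (n : ℕ) : ∀ S : Finset Pt, S.card = n → S.Nonempty → Hered S →
    ∃ l j, Lab S l j := by
  induction n using Nat.strong_induction_on with
  | _ n ih =>
    intro S hn hne hH
    rcases (core S).eq_empty_or_nonempty with hc | hc
    · exact base0 hH hne hc
    by_cases h1 : (core S).card = 1
    · exact base1 hH h1
    have h2 : 2 ≤ (core S).card := by
      have := Finset.card_pos.2 hc
      omega
    have h3 := card_S S
    have h4 := Finset.card_pos.2 (ext_nonempty hne)
    obtain ⟨l0, j, hL⟩ := ih (core S).card (by omega) (core S) rfl hc hH.core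
    obtain ⟨l, hl⟩ := lab_step hH h2 hL
    exact ⟨l, j + 1, hl⟩


lemma hp_convex (a b : Pt) : Convex ℝ {x : Pt | 0 ≤ orient a b x} := by
  intro x hx y hy s t hs ht hst
  simp only [Set.mem_setOf_eq] at hx hy ⊢
  have e : orient a b (s • x + t • y) = s * orient a b x + t * orient a b y := by
    have : t = 1 - s := by linarith
    subst this
    simp [orient]; ring
  rw [e]; positivity

lemma o_cont (a b : Pt) : Continuous fun x : Pt => orient a b x := by
  unfold orient; fun_prop

lemma hull_le {a b c p : Pt} (h : 0 < orient a b c) (hp : p ∈ convexHull ℝ ({a, b, c} : Set Pt)) :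
    0 ≤ orient a b p ∧ 0 ≤ orient b c p ∧ 0 ≤ orient c a p := by
  refine ⟨?_, ?_, ?_⟩
  · refine convexHull_min (t := {x : Pt | 0 ≤ orient a b x}) ?_ (hp_convex a b) hp
    rintro x (rfl | rfl | rfl)
    · simp [o_aba]
    · simp [o_baa]
    · exact h.le
  · refine convexHull_min (t := {x : Pt | 0 ≤ orient b c x}) ?_ (hp_convex b c) hp
    rintro x (rfl | rfl | rfl)
    · simp only [Set.mem_setOf_eq]; rw [o_rot]; exact h.le
    · simp [o_aba]
    · simp [o_baa]
  · refine convexHull_min (t := {x : Pt | 0 ≤ orient c a x}) ?_ (hp_convex c a) hp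
    rintro x (rfl | rfl | rfl)
    · simp [o_baa]
    · simp only [Set.mem_setOf_eq]; rw [o_rot2]; exact h.le
    · simp [o_aba]

lemma InT_hull {a b c p : Pt} (h : InT a b c p) : p ∈ convexHull ℝ ({a, b, c} : Set Pt) := by
  obtain ⟨h1, h2, h3⟩ := h
  have hD := o_sum p a b c
  have hDpos : 0 < orient a b c := by rw [hD]; positivity
  have key := (convex_convexHull ℝ ({a, b, c} : Set Pt)).sum_mem (t := Finset.univ)
    (w := ![orient b c p / orient a b c, orient c a p / orient a b c,
      orient a b p / orient a b c]) (z := ![a, b, c]) ?_ ?_ ?_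
  · rw [Fin.sum_univ_three] at key
    convert key using 1
    apply Prod.ext
    · simp
      field_simp
      simp only [orient]; ring
    · simp
      field_simp
      simp only [orient]; ring
  · intro i _
    fin_cases i <;> simp <;> positivity
  · rw [Fin.sum_univ_three]
    simp
    rw [← add_div, ← add_div, div_eq_one_iff_eq hDpos.ne']
    linarith
  · intro i _
    apply subset_convexHull
    fin_cases i <;> simp

lemma InT_interior {a b c p : Pt} (h : InT a b c p) :
    p ∈ interior (convexHull ℝ ({a, b, c} : Set Pt)) := by
  refine interior_maximal (t := {x | InT a b c x}) (fun x hx => InT_hull hx) ?_ h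
  have e : {x | InT a b c x} = {x | 0 < orient a b x} ∩ ({x | 0 < orient b c x} ∩
      {x | 0 < orient c a x}) := rfl
  rw [e]
  exact (isOpen_lt continuous_const (o_cont a b)).inter
    ((isOpen_lt continuous_const (o_cont b c)).inter (isOpen_lt continuous_const (o_cont c a)))

lemma InT_iff {S : Finset Pt} (hS : GP S) {a b c p : Pt} (ha : a ∈ ext S) (hb : b ∈ ext S)
    (hc : c ∈ ext S) (hp : p ∈ core S) (h : 0 < orient a b c) :
    InT a b c p ↔ p ∈ interior (convexHull ℝ ({a, b, c} : Set Pt)) := by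
  refine ⟨InT_interior, fun hi => ?_⟩
  obtain ⟨h1, h2, h3⟩ := hull_le h (interior_subset hi)
  have pa := ext_ne_core ha hp
  have pb := ext_ne_core hb hp
  have pc := ext_ne_core hc hp
  have ma := ext_sub S ha
  have mb := ext_sub S hb
  have mc := ext_sub S hc
  have mp := core_sub S hp
  exact ⟨lt_of_le_of_ne h1 (hS a ma b mb p mp (o_ne12 h) pa pb).symm,
    lt_of_le_of_ne h2 (hS b mb c mc p mp (o_ne23 h) pb pc).symm,
    lt_of_le_of_ne h3 (hS c mc a ma p mp (o_ne13 h).symm pc pa).symm⟩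

lemma peel_coe (S : Finset Pt) : peel ↑S = ↑(core S) := by
  unfold peel core
  rw [Finset.coe_sdiff, ext_coe]

lemma peel_iter (S : Finset Pt) (i : ℕ) : peel^[i] ↑S = ↑(core^[i] S) := by
  induction i with
  | zero => rfl
  | succ i ih => rw [Function.iterate_succ_apply', Function.iterate_succ_apply', ih, peel_coe]

lemma core_iter_sub (S : Finset Pt) (i : ℕ) : core^[i] S ⊆ S := by
  induction i with
  | zero => exact Finset.Subset.refl _
  | succ i ih =>
    rw [Function.iterate_succ_apply']
    exact (core_sub _).trans ih

lemma core_iter_card (S : Finset Pt) (i : ℕ) : core^[i] S = ∅ ∨ (core^[i] S).card + i ≤ S.card := by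
  induction i with
  | zero => right; simp
  | succ i ih =>
    rw [Function.iterate_succ_apply']
    by_cases h0 : core^[i] S = ∅
    · left; rw [h0]; simp [core]
    · right
      have h1 := card_S (core^[i] S)
      have h2 := (ext_nonempty (Finset.nonempty_iff_ne_empty.2 h0)).card_pos
      have := ih.resolve_left h0
      omega

lemma nacs_hered {S : Finset Pt} (h : IsNACS ↑S) : Hered S := by
  obtain ⟨_, _, hG, hL⟩ := h
  have hGP : GP S := fun a ha b hb c hc => hG a (by exact_mod_cast ha) b (by exact_mod_cast hb) c
    (by exact_mod_cast hc)
  refine ⟨hGP, fun i => ?_⟩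
  have hex : ∃ k, peel^[k] (↑S : Set Pt) = ∅ := by
    refine ⟨S.card + 1, ?_⟩
    rw [peel_iter]
    rcases core_iter_card S (S.card + 1) with h | h
    · rw [h]; simp
    · omega
  have hk : HasLayers ↑S (Nat.find hex) := ⟨Nat.find_spec hex, fun j hj => Nat.find_min hex hj⟩
  generalize Nat.find hex = k at hk
  intro a ha b hb c hc habc
  have hne : (core^[i] S) ≠ ∅ := by
    intro h0
    have := ext_sub _ ha
    rw [h0] at this
    simp at this
  have hik : i < k := by
    by_contra hcon
    have h1 := hk.1
    rw [peel_iter] at h1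
    have h2 : core^[k] S = ∅ := by exact_mod_cast h1
    have h3 : core^[i] S ⊆ core^[k] S := by
      have e : i = (i - k) + k := by omega
      rw [e, Function.iterate_add_apply]
      exact core_iter_sub _ _
    rw [h2] at h3
    exact hne (Finset.subset_empty.1 h3)
  have e1 : layerSub ↑S k (k - i) = ↑(core^[i] S) := by
    unfold layerSub
    rw [show k - (k - i) = i by omega, peel_iter]
  have e2 : layerSub ↑S k (k - i - 1) = ↑(core (core^[i] S)) := by
    unfold layerSub
    rw [show k - (k - i - 1) = i + 1 by omega, peel_iter, Function.iterate_succ_apply']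
  have e3 : layer ↑S k (k - i) = ↑(ext (core^[i] S)) := by
    unfold layer
    rw [e1, ext_coe]
  have key := hL k hk (k - i) (by omega) (by omega)
  rw [e2, e3] at key
  obtain ⟨p, ⟨hp1, hp2⟩, hp3⟩ := key a (by exact_mod_cast ha) b (by exact_mod_cast hb) c
    (by exact_mod_cast hc) (o_ne12 habc) (o_ne13 habc) (o_ne23 habc)
  have hGi : GP (core^[i] S) := hGP.mono (core_iter_sub S i)
  have hp1' : p ∈ core (core^[i] S) := by exact_mod_cast hp1
  refine ⟨p, ⟨hp1', (InT_iff hGi ha hb hc hp1' habc).2 hp2⟩, ?_⟩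
  rintro q ⟨hq1, hq2⟩
  exact hp3 q ⟨by exact_mod_cast hq1, (InT_iff hGi ha hb hc hq1 habc).1 hq2⟩

lemma pow_bound {j n : ℕ} (h : 2 ^ j ≤ 2 * n) :
    (5 : ℝ) ^ j ≤ 5 * (n : ℝ) ^ (Real.logb 2 5) := by
  have h5 : (2 : ℝ) ^ (Real.logb 2 5) = 5 :=
    Real.rpow_logb (by norm_num) (by norm_num) (by norm_num)
  have hpos : 0 ≤ Real.logb 2 5 := Real.logb_nonneg (by norm_num) (by norm_num)
  have h1 : ((2 : ℝ) ^ j) ^ (Real.logb 2 5) = 5 ^ j := by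
    rw [← Real.rpow_natCast, ← Real.rpow_mul (by norm_num), mul_comm, Real.rpow_mul (by norm_num),
      h5, Real.rpow_natCast]
  have h2 : ((2 : ℝ) ^ j) ≤ 2 * n := by exact_mod_cast h
  rw [← h1]
  calc ((2 : ℝ) ^ j) ^ (Real.logb 2 5) ≤ (2 * (n : ℝ)) ^ (Real.logb 2 5) :=
        Real.rpow_le_rpow (by positivity) h2 hpos
    _ = 5 * (n : ℝ) ^ (Real.logb 2 5) := by
        rw [Real.mul_rpow (by norm_num) (by positivity), h5]

lemma o_smul (r : ℝ) (a b c : Pt) : orient (r • a) (r • b) (r • c) = r ^ 2 * orient a b c := by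
  simp [orient]; ring

lemma yy_grid {s : List Bool} {j : ℕ} (h : s.length ≤ j) :
    ∃ A B : ℤ, ((100 * 5 ^ j : ℝ) • yy s) = ((A : ℝ), (B : ℝ)) ∧
      |(A : ℝ)| ≤ 25 * 5 ^ j ∧ |(B : ℝ)| ≤ 25 * 5 ^ j := by
  obtain ⟨A, B, hA, hB⟩ := yy_int s
  obtain ⟨b1, b2, b3, b4⟩ := box_yy s
  obtain ⟨d, rfl⟩ := Nat.exists_eq_add_of_le h
  have e1 : (100 * 5 ^ (s.length + d) : ℝ) * (yy s).1 = ((A * 5 ^ d : ℤ) : ℝ) := by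
    push_cast; rw [← hA, pow_add]; ring
  have e2 : (100 * 5 ^ (s.length + d) : ℝ) * (yy s).2 = ((B * 5 ^ d : ℤ) : ℝ) := by
    push_cast; rw [← hB, pow_add]; ring
  have hp : (0 : ℝ) < 5 ^ (s.length + d) := by positivity
  refine ⟨A * 5 ^ d, B * 5 ^ d, ?_, ?_, ?_⟩
  · rw [← e1, ← e2]; rfl
  · rw [← e1, abs_of_nonneg (by positivity)]; nlinarith
  · rw [← e2, abs_of_nonneg (by positivity)]; nlinarith


/-- Every nested almost convex set of `n ≥ 1` points admits a drawing on an
integer grid of size `O(n^(log₂ 5))`. -/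
theorem nacs_drawing_grid_size :
    ∃ C : ℝ, 0 < C ∧
      ∀ X : Set Pt, IsNACS X → 1 ≤ X.ncard →
        ∃ (Y : Set Pt) (f : Pt → Pt), Set.BijOn f X Y ∧
          (∀ p ∈ Y, ∃ a b : ℤ, p = ((a : ℝ), (b : ℝ)) ∧
            |(a : ℝ)| ≤ C * (X.ncard : ℝ) ^ (Real.logb 2 5) ∧
            |(b : ℝ)| ≤ C * (X.ncard : ℝ) ^ (Real.logb 2 5)) ∧
          ∀ a ∈ X, ∀ b ∈ X, ∀ c ∈ X, a ≠ b → a ≠ c → b ≠ c →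
            (0 < orient a b c ↔ 0 < orient (f a) (f b) (f c)) := by
  refine ⟨125, by norm_num, fun X hX hn => ?_⟩
  obtain ⟨S, rfl⟩ : ∃ S : Finset Pt, (↑S : Set Pt) = X := ⟨hX.1.toFinset, hX.1.coe_toFinset⟩
  have hne : S.Nonempty := by exact_mod_cast hX.2.1
  obtain ⟨l, j, hl⟩ := lab_exists S.card S rfl hne (nacs_hered hX)
  rw [Set.ncard_coe_finset]
  have hr : (0 : ℝ) < 100 * 5 ^ j := by positivity
  have hb := pow_bound hl.card
  refine ⟨(fun p => (100 * 5 ^ j : ℝ) • yy (l p)) '' (↑S : Set Pt),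
    fun p => (100 * 5 ^ j : ℝ) • yy (l p), ?_, ?_, ?_⟩
  · apply Set.InjOn.bijOn_image
    intro x hx y hy hxy
    have h1 : yy (l x) = yy (l y) := smul_right_injective Pt hr.ne' hxy
    exact hl.inj x (by exact_mod_cast hx) y (by exact_mod_cast hy) (yy_inj _ _ h1)
  · rintro _ ⟨p, hp, rfl⟩
    obtain ⟨A, B, e, hA, hB⟩ := yy_grid (hl.le p (by exact_mod_cast hp))
    exact ⟨A, B, e, by linarith, by linarith⟩
  · intro a ha b hb' c hc hab hac hbc
    have h := hl.pos a (by exact_mod_cast ha) b (by exact_mod_cast hb') c (by exact_mod_cast hc)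
      hab hac hbc
    unfold DD at h
    dsimp only
    rw [o_smul, mul_pos_iff_of_pos_left (by positivity)]
    constructor
    · intro h0; exact (mul_pos_iff_of_pos_left h0).1 h
    · intro h0; exact (mul_pos_iff_of_pos_right h0).1 h
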